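/- arXiv:math/9408204 — 2 statements merged into one kernel-verified Lean document; each statement's English description precedes it below -/
import Mathlib

section
/- Generalized Higman theorem (GHT): If (Q, ⪯) is a bqo then Q^{<ω}, the set of finite sequences of elements of Q ordered by embeddability (s ≤ t iff there is a strictly increasing map f : {0,…,lh(s)−1} → {0,…,lh(t)−1} with s(i) ⪯ t(f(i)) for all i), is a bqo. -/
/-- `s ◁ t`: there is a finite sequence `u` with `s` an initial segment of `u`
and `t` an initial segment of `u` with its first element removed. -/
def Tri (s t : List ℕ) : Prop := ∃ u : List ℕ, s <+: u ∧ t <+: u.tail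

/-- The base of a set of finite sequences: all naturals occurring in some member. -/
def base (B : Set (List ℕ)) : Set ℕ := {n | ∃ s ∈ B, n ∈ s}

/-- `B` is a block: all members are strictly increasing, the base is infinite,
every infinite subset of the base (given by its increasing enumeration `f`)
has an initial segment in `B`, and no member is a proper initial segment of another. -/
def IsBlock (B : Set (List ℕ)) : Prop :=
  (∀ s ∈ B, s.Chain' (· < ·)) ∧
  (base B).Infinite ∧
  (∀ f : ℕ → ℕ, StrictMono f → (∀ n, f n ∈ base B) →
    ∃ k, (List.range k).map f ∈ B) ∧
  ∀ s ∈ B, ∀ t ∈ B, s <+: t → s = t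

/-- `B` is a barrier: as a block, but no member's range is properly contained
in the range of another member. -/
def IsBarrier (B : Set (List ℕ)) : Prop :=
  (∀ s ∈ B, s.Chain' (· < ·)) ∧
  (base B).Infinite ∧
  (∀ f : ℕ → ℕ, StrictMono f → (∀ n, f n ∈ base B) →
    ∃ k, (List.range k).map f ∈ B) ∧
  ∀ s ∈ B, ∀ t ∈ B, (∀ n, n ∈ s → n ∈ t) → ∀ n, n ∈ t → n ∈ s

/-- Higman embeddability on finite sequences over the quasi-order `Q`. -/
def ListLE {Q : Type} [Preorder Q] (s t : List Q) : Prop :=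
  ∃ g : Fin s.length → Fin t.length, StrictMono g ∧ ∀ i, s.get i ≤ t.get (g i)


namespace GHT

def Init (s : List ℕ) (X : Set ℕ) : Prop :=
  (∀ k ∈ s, k ∈ X) ∧ ∀ k ∈ X, k ∉ s → ∀ j ∈ s, j < k

def Shift (X : Set ℕ) : Set ℕ := {x | x ∈ X ∧ ∃ y ∈ X, y < x}

structure NB (B : Set (List ℕ)) : Prop where
  sorted : ∀ s ∈ B, s.Pairwise (· < ·)
  bar : ∀ X : Set ℕ, X ⊆ base B → X.Infinite → ∃ s ∈ B, Init s X
  anti : ∀ s ∈ B, ∀ t ∈ B, (∀ n ∈ s, n ∈ t) → ∀ n ∈ t, n ∈ s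
  len : ∀ s ∈ B, 2 ≤ s.length

theorem bar_of_barrier {B : Set (List ℕ)} (hB : IsBarrier B) (X : Set ℕ) (hX : X ⊆ base B)
    (hi : X.Infinite) : ∃ s ∈ B, Init s X := by
  have hm : StrictMono (Nat.nth (· ∈ X)) := Nat.nth_strictMono hi
  obtain ⟨k, hk⟩ := hB.2.2.1 _ hm (fun n => hX (Nat.nth_mem_of_infinite hi n))
  refine ⟨_, hk, ?_, ?_⟩
  · intro j hj
    simp only [List.mem_map, List.mem_range] at hj
    obtain ⟨i, _, rfl⟩ := hj
    exact Nat.nth_mem_of_infinite hi i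
  · intro x hx hn j hj
    simp only [List.mem_map, List.mem_range] at hj hn
    obtain ⟨i, h1, rfl⟩ := hj
    obtain ⟨l, rfl⟩ : ∃ l, Nat.nth (· ∈ X) l = x := by
      have : x ∈ Set.range (Nat.nth (· ∈ X)) := by
        have h := Nat.range_nth_of_infinite (p := (· ∈ X)) hi
        rw [h]; exact hx
      exact this
    apply hm
    by_contra h
    exact hn ⟨l, by omega, rfl⟩

theorem sorted_ext {s t : List ℕ} (hs : s.Pairwise (· < ·)) (ht : t.Pairwise (· < ·))
    (h : ∀ k, k ∈ s ↔ k ∈ t) : s = t := by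
  have hp : s.Perm t := by
    rw [List.perm_ext_iff_of_nodup]
    · exact h
    · exact hs.imp (fun h => ne_of_lt h)
    · exact ht.imp (fun h => ne_of_lt h)
  exact hp.eq_of_pairwise (fun a b _ _ h1 h2 => absurd h1 (not_lt.2 h2.le)) hs ht

theorem NB.init_unique {B : Set (List ℕ)} (h : NB B) {s t : List ℕ} {X : Set ℕ} (hs : s ∈ B)
    (ht : t ∈ B) (h1 : Init s X) (h2 : Init t X) : s = t := by
  have key : ∀ s ∈ B, ∀ t ∈ B, Init s X → Init t X → ∀ k ∈ s, k ∈ t := by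
    intro s hs t ht h1 h2 k hk
    by_contra hkt
    have h3 := h2.2 k (h1.1 k hk) hkt
    have h4 : ∀ j ∈ t, j ∈ s := by
      intro j hj
      by_contra hjs
      exact absurd (h1.2 j (h2.1 j hj) hjs k hk) (not_lt.2 (h3 j hj).le)
    exact hkt (h.anti t ht s hs h4 k hk)
  exact sorted_ext (h.sorted s hs) (h.sorted t ht)
    (fun k => ⟨key s hs t ht h1 h2 k, key t ht s hs h2 h1 k⟩)

theorem NB.tri {B : Set (List ℕ)} (h : NB B) {s t : List ℕ} (hs : s ∈ B)
    (ht : t ∈ B) (hT : Tri s t) : ∃ a s' r, s = a :: s' ∧ t = s' ++ r ∧ (∀ k ∈ t, a < k) := by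
  obtain ⟨u, ⟨v, rfl⟩, h2⟩ := hT
  have hl := h.len s hs
  have hso := h.sorted s hs
  have hto := h.sorted t ht
  match s, hs, hl, hso, h2 with
  | a :: b :: s'', hs, _, hso, h2 =>
    have h2' : t <+: (b :: s'') ++ v := by simpa using h2
    rcases List.prefix_or_prefix_of_prefix h2' (List.prefix_append (b :: s'') v) with h3 | h3
    · exfalso
      have := h.anti t ht _ hs (fun n hn => List.mem_cons_of_mem _ (h3.subset hn)) a (by simp)
      have := h3.subset this
      rw [List.pairwise_cons] at hso
      exact lt_irrefl _ (hso.1 a this)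
    · obtain ⟨r, rfl⟩ := h3
      refine ⟨a, b :: s'', r, rfl, rfl, ?_⟩
      rw [List.pairwise_cons] at hso
      have hab := hso.1 b (by simp)
      rw [List.cons_append, List.pairwise_cons] at hto
      intro k hk
      rw [List.cons_append, List.mem_cons] at hk
      rcases hk with rfl | hk
      · exact hab
      · exact hab.trans (hto.1 k hk)

theorem init_prefix : ∀ (s t : List ℕ) (X : Set ℕ), s.Pairwise (· < ·) → t.Pairwise (· < ·) →
    Init s X → Init t X → s <+: t ∨ t <+: s
  | [], t, _, _, _, _, _ => Or.inl (List.nil_prefix)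
  | _ :: _, [], _, _, _, _, _ => Or.inr (List.nil_prefix)
  | a :: s, b :: t, X, hs, ht, h1, h2 => by
    have e1 : ∀ (a : ℕ) (s : List ℕ), (a :: s).Pairwise (· < ·) → Init (a :: s) X →
        a ∈ X ∧ ∀ k ∈ X, a ≤ k := by
      intro a s hs h1
      refine ⟨h1.1 a (by simp), fun k hk => ?_⟩
      by_cases hk' : k ∈ a :: s
      · rw [List.pairwise_cons] at hs
        rcases List.mem_cons.1 hk' with rfl | h
        · exact le_rfl
        · exact (hs.1 k h).le
      · exact (h1.2 k hk hk' a (by simp)).le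
    have e2 : ∀ (a : ℕ) (s : List ℕ), (a :: s).Pairwise (· < ·) → Init (a :: s) X →
        Init s (X \ {a}) := by
      intro a s hs h1
      rw [List.pairwise_cons] at hs
      refine ⟨fun k hk => ⟨h1.1 k (by simp [hk]), ?_⟩, fun k hk hks j hj => ?_⟩
      · have := hs.1 k hk
        simp; omega
      · refine h1.2 k hk.1 ?_ j (by simp [hj])
        have := hk.2
        simp at this
        simp [this, hks]
    have hab : a = b := le_antisymm ((e1 a s hs h1).2 b (e1 b t ht h2).1)
      ((e1 b t ht h2).2 a (e1 a s hs h1).1)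
    subst hab
    have := init_prefix s t (X \ {a}) (List.pairwise_cons.1 hs).2 (List.pairwise_cons.1 ht).2
      (e2 a s hs h1) (e2 a t ht h2)
    simpa [List.cons_prefix_cons] using this

theorem infinite_above {A : Set ℕ} (hA : A.Infinite) (m : ℕ) : {k | k ∈ A ∧ m ≤ k}.Infinite := by
  have : {k | k ∈ A ∧ m ≤ k} = A \ Set.Iio m := by
    ext k; simp
  rw [this]
  exact hA.sdiff (Set.finite_Iio m)

theorem lt_sum {s : List ℕ} {j : ℕ} (hj : j ∈ s) : j < s.sum + 1 :=
  Nat.lt_succ_of_le (List.le_sum_of_mem hj)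

/-- every member has a successor -/
theorem NB.exists_succ {B : Set (List ℕ)} (h : NB B) {A : Set ℕ} (hA : A.Infinite)
    (hAB : A ⊆ base B) {s : List ℕ} (hs : s ∈ B) (hsA : ∀ k ∈ s, k ∈ A) :
    ∃ t ∈ B, (∀ k ∈ t, k ∈ A) ∧ Tri s t := by
  have hl := h.len s hs
  have hso := h.sorted s hs
  match s, hs, hl, hso, hsA with
  | a :: s', hs, _, hso, hsA =>
    rw [List.pairwise_cons] at hso
    let Z : Set ℕ := {k | k ∈ s' ∨ (k ∈ A ∧ s'.sum + 1 ≤ k)}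
    have hZA : Z ⊆ A := by
      rintro k (hk | hk)
      · exact hsA k (by simp [hk])
      · exact hk.1
    have hZ : Z.Infinite := (infinite_above hA (s'.sum + 1)).mono (fun k hk => Or.inr hk)
    obtain ⟨t, ht, hi⟩ := h.bar Z (hZA.trans hAB) hZ
    refine ⟨t, ht, fun k hk => hZA (hi.1 k hk), ?_⟩
    have hi' : Init s' Z := by
      refine ⟨fun k hk => Or.inl hk, fun k hk hks j hj => ?_⟩
      rcases hk with hk | hk
      · exact absurd hk hks
      · exact lt_of_lt_of_le (lt_sum hj) hk.2
    rcases init_prefix s' t Z hso.2 (h.sorted t ht) hi' hi with h3 | h3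
    · exact ⟨a :: t, by simpa [List.cons_prefix_cons] using h3, by simp⟩
    · exact ⟨a :: s', by simp, by simpa using h3⟩

/-- clopen Ramsey theorem -/
theorem clopen_ramsey (A : Set ℕ) (hA : A.Infinite) (c : Set ℕ → Prop)
    (hc : ∀ X ⊆ A, X.Infinite → ∃ n : ℕ, ∀ Y ⊆ A, Y.Infinite →
      (∀ k < n, (k ∈ Y ↔ k ∈ X)) → (c Y ↔ c X)) :
    ∃ C ⊆ A, C.Infinite ∧ ((∀ X ⊆ C, X.Infinite → c X) ∨ (∀ X ⊆ C, X.Infinite → ¬ c X)) := by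
  let R : Set ℕ → ℕ → Prop := fun u m => ∀ A' ⊆ A, A'.Infinite → (∀ k ∈ A', m ≤ k) →
    ∃ C ⊆ A', C.Infinite ∧ ∃ e : Prop, ∀ X ⊆ C, X.Infinite → (c (u ∪ X) ↔ e)
  have step : ∀ u m, (∀ a ∈ A, m ≤ a → R (u ∪ {a}) (a + 1)) → R u m := by
    intro u m H A' hA' hi hm
    -- fusion
    let S := {D : Set ℕ // D ⊆ A' ∧ D.Infinite}
    have hmin : ∀ D : S, ∃ a ∈ D.1, ∀ k ∈ D.1, a ≤ k := fun D =>
      ⟨sInf D.1, Nat.sInf_mem D.2.2.nonempty, fun k hk => Nat.sInf_le hk⟩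
    have hnext : ∀ D : S, ∃ p : ℕ × S × Prop, p.1 ∈ D.1 ∧ p.2.1.1 ⊆ D.1 ∧
        (∀ k ∈ p.2.1.1, p.1 < k) ∧
        ∀ X ⊆ p.2.1.1, X.Infinite → (c ((u ∪ {p.1}) ∪ X) ↔ p.2.2) := by
      intro D
      obtain ⟨a, ha, _⟩ := hmin D
      obtain ⟨C, hC, hCi, e, he⟩ := H a (hA' (D.2.1 ha)) (hm a (D.2.1 ha))
        {k | k ∈ D.1 ∧ a + 1 ≤ k} (fun k hk => hA' (D.2.1 hk.1)) (infinite_above D.2.2 _)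
        (fun k hk => hk.2)
      exact ⟨(a, ⟨C, fun k hk => D.2.1 (hC hk).1, hCi⟩, e), ha, fun k hk => (hC hk).1,
        fun k hk => (hC hk).2, he⟩
    choose p hp1 hp2 hp3 hp4 using hnext
    let D : ℕ → S := fun i => Nat.rec ⟨A', subset_rfl, hi⟩ (fun _ D => (p D).2.1) i
    have hD : ∀ i, D (i + 1) = (p (D i)).2.1 := fun i => rfl
    let a : ℕ → ℕ := fun i => (p (D i)).1
    let e : ℕ → Prop := fun i => (p (D i)).2.2
    have hanti : Antitone (fun i => (D i).1) := antitone_nat_of_succ_le (fun i => by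
      rw [hD]; exact hp2 _)
    have haD : ∀ i j, i ≤ j → a j ∈ (D i).1 := fun i j hij => hanti hij (hp1 (D j))
    have hmono : StrictMono a := strictMono_nat_of_lt_succ (fun i => hp3 (D i) _ (by
      rw [← hD]; exact haD (i+1) (i+1) le_rfl))
    obtain ⟨I, hI, E, hE⟩ : ∃ I : Set ℕ, I.Infinite ∧ ∃ E : Prop, ∀ i ∈ I, (e i ↔ E) := by
      by_cases h : {i | e i}.Infinite
      · exact ⟨_, h, True, fun i hi => by simpa using hi⟩
      · refine ⟨_, (Set.not_infinite.1 h).infinite_compl, False, fun i hi => by simpa using hi⟩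
    refine ⟨a '' I, ?_, hI.image hmono.injective.injOn, E, ?_⟩
    · rintro _ ⟨i, _, rfl⟩
      exact (D i).2.1 (hp1 _)
    · intro X hX hXi
      have hx0 := Nat.sInf_mem hXi.nonempty
      obtain ⟨i, hiI, hi0⟩ := hX hx0
      have hXeq : u ∪ X = (u ∪ {a i}) ∪ (X \ {a i}) := by
        ext k
        have : a i ∈ X := hi0 ▸ hx0
        by_cases hk : k = a i <;> simp [hk, this]
      rw [hXeq]
      rw [hp4 (D i) (X \ {a i}) ?_ (hXi.sdiff (Set.finite_singleton _))]
      · exact hE i hiI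
      · rintro k ⟨hk, hk2⟩
        obtain ⟨j, _, rfl⟩ := hX hk
        have h1 : a i ≤ a j := by rw [hi0]; exact Nat.sInf_le hk
        have h2 : a i ≠ a j := fun h => hk2 (by simp [h])
        have : i < j := hmono.lt_iff_lt.1 (lt_of_le_of_ne h1 h2)
        rw [← hD]
        exact haD _ _ this
  have main : R ∅ 0 := by
    by_contra hR
    let S := {q : Set ℕ × ℕ // ¬ R q.1 q.2}
    have hnext : ∀ q : S, ∃ a ∈ A, q.1.2 ≤ a ∧ ¬ R (q.1.1 ∪ {a}) (a + 1) := by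
      intro q
      by_contra hcon
      push Not at hcon
      exact q.2 (step _ _ hcon)
    choose a ha1 ha2 ha3 using hnext
    let q : ℕ → S := fun i => Nat.rec ⟨(∅, 0), hR⟩
      (fun _ q => ⟨(q.1.1 ∪ {a q}, a q + 1), ha3 q⟩) i
    have hq1 : ∀ i, (q (i+1)).1.1 = (q i).1.1 ∪ {a (q i)} := fun i => rfl
    have hq2 : ∀ i, (q (i+1)).1.2 = a (q i) + 1 := fun i => rfl
    have hmono : StrictMono (fun i => a (q i)) := strictMono_nat_of_lt_succ (fun i => by
      have := ha2 (q (i+1)); rw [hq2] at this; exact this)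
    have hu : ∀ i k, k ∈ (q i).1.1 ↔ ∃ j < i, a (q j) = k := by
      intro i
      induction i with
      | zero => intro k; simp [q]
      | succ i ih =>
        intro k
        rw [hq1, Set.mem_union, ih]
        constructor
        · rintro (⟨j, hj, h⟩ | h)
          · exact ⟨j, by omega, h⟩
          · exact ⟨i, by omega, by simpa using h.symm⟩
        · rintro ⟨j, hj, h⟩
          rcases Nat.lt_succ_iff_lt_or_eq.1 hj with h' | rfl
          · exact Or.inl ⟨j, h', h⟩
          · right; simp [h]
    let X := Set.range (fun i => a (q i))
    have hXA : X ⊆ A := by rintro _ ⟨i, rfl⟩; exact ha1 _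
    obtain ⟨n, hn⟩ := hc X hXA (Set.infinite_range_of_injective hmono.injective)
    apply (q (n+1)).2
    intro A' hA' hi hm
    refine ⟨A', subset_rfl, hi, c X, fun Y hY hYi => ?_⟩
    apply hn
    · rintro k (hk | hk)
      · obtain ⟨j, _, rfl⟩ := (hu (n+1) _).1 hk
        exact ha1 _
      · exact hA' (hY hk)
    · exact hYi.mono Set.subset_union_right
    · intro k hk
      constructor
      · rintro (h | h)
        · obtain ⟨j, _, rfl⟩ := (hu (n+1) _).1 h
          exact ⟨j, rfl⟩
        · have h1 := hm k (hY h)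
          rw [hq2] at h1
          have h2 : n ≤ a (q n) := hmono.id_le n
          omega
      · rintro ⟨j, rfl⟩
        left
        refine (hu (n+1) _).2 ⟨j, ?_, rfl⟩
        have h2 : j ≤ a (q j) := hmono.id_le j
        simp only at hk
        omega
  obtain ⟨C, hC, hCi, e, he⟩ := main A subset_rfl hA (by simp)
  refine ⟨C, hC, hCi, ?_⟩
  by_cases h : e
  · left; intro X h1 h2; have := he X h1 h2; simp at this; exact this.2 h
  · right; intro X h1 h2; have := he X h1 h2; simp at this; rw [this]; exact h

theorem NB.ramsey {B : Set (List ℕ)} (h : NB B) {A : Set ℕ} (hA : A.Infinite)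
    (hAB : A ⊆ base B) (P : List ℕ → List ℕ → Prop) :
    ∃ C ⊆ A, C.Infinite ∧
      ((∀ s ∈ B, ∀ t ∈ B, (∀ k ∈ s, k ∈ C) → (∀ k ∈ t, k ∈ C) → Tri s t → P s t) ∨
       (∀ s ∈ B, ∀ t ∈ B, (∀ k ∈ s, k ∈ C) → (∀ k ∈ t, k ∈ C) → Tri s t → ¬ P s t)) := by
  let c : Set ℕ → Prop := fun X => ∀ s ∈ B, ∀ t ∈ B, Init s X → Init t (Shift X) → P s t
  have hcP : ∀ X s t, s ∈ B → t ∈ B → Init s X → Init t (Shift X) → (c X ↔ P s t) := by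
    intro X s t hs ht h1 h2
    refine ⟨fun hc => hc s hs t ht h1 h2, fun hp s' hs' t' ht' h1' h2' => ?_⟩
    rw [h.init_unique hs' hs h1' h1, h.init_unique ht' ht h2' h2]
    exact hp
  have hsh : ∀ X : Set ℕ, X.Infinite → (Shift X).Infinite := by
    intro X hX
    refine (infinite_above hX (sInf X + 1)).mono (fun k hk => ⟨hk.1, sInf X, Nat.sInf_mem hX.nonempty, hk.2⟩)
  obtain ⟨C, hCA, hCi, hC⟩ := clopen_ramsey A hA c (by
    intro X hXA hXi
    obtain ⟨s, hs, h1⟩ := h.bar X (hXA.trans hAB) hXi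
    obtain ⟨t, ht, h2⟩ := h.bar (Shift X) (fun k hk => hAB (hXA hk.1)) (hsh X hXi)
    refine ⟨s.sum + t.sum + 1, fun Y hYA hYi hY => ?_⟩
    have hsn : ∀ j ∈ s, j < s.sum + t.sum + 1 := fun j hj => by have := lt_sum hj; omega
    have htn : ∀ j ∈ t, j < s.sum + t.sum + 1 := fun j hj => by have := lt_sum hj; omega
    rw [hcP X s t hs ht h1 h2]
    have hS : ∀ k < s.sum + t.sum + 1, (k ∈ Shift Y ↔ k ∈ Shift X) := by
      intro k hk
      constructor
      · rintro ⟨h3, y, h4, h5⟩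
        exact ⟨(hY k hk).1 h3, y, (hY y (by omega)).1 h4, h5⟩
      · rintro ⟨h3, y, h4, h5⟩
        exact ⟨(hY k hk).2 h3, y, (hY y (by omega)).2 h4, h5⟩
    apply hcP Y s t hs ht
    · refine ⟨fun k hk => (hY k (hsn k hk)).2 (h1.1 k hk), fun k hk hks j hj => ?_⟩
      by_cases hkn : k < s.sum + t.sum + 1
      · exact h1.2 k ((hY k hkn).1 hk) hks j hj
      · have := hsn j hj; omega
    · refine ⟨fun k hk => (hS k (htn k hk)).2 (h2.1 k hk), fun k hk hks j hj => ?_⟩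
      by_cases hkn : k < s.sum + t.sum + 1
      · exact h2.2 k ((hS k hkn).1 hk) hks j hj
      · have := htn j hj; omega)
  refine ⟨C, hCA, hCi, ?_⟩
  have key : ∀ s ∈ B, ∀ t ∈ B, (∀ k ∈ s, k ∈ C) → (∀ k ∈ t, k ∈ C) → Tri s t →
      ∃ X ⊆ C, X.Infinite ∧ (c X ↔ P s t) := by
    intro s hs t ht hsC htC hT
    obtain ⟨a, s', r, e1, e2, e3⟩ := h.tri hs ht hT
    have hso := h.sorted s hs
    have hto := h.sorted t ht
    have htl := h.len t ht
    let X : Set ℕ := {k | k = a ∨ k ∈ t ∨ (k ∈ C ∧ a + t.sum + 1 ≤ k)}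
    have hXC : X ⊆ C := by
      rintro k (rfl | hk | hk)
      · exact hsC _ (by simp [e1])
      · exact htC k hk
      · exact hk.1
    have hXi : X.Infinite := (infinite_above hCi (a + t.sum + 1)).mono
      (fun k hk => Or.inr (Or.inr hk))
    refine ⟨X, hXC, hXi, hcP X s t hs ht ?_ ?_⟩
    · constructor
      · intro k hk
        rw [e1, List.mem_cons] at hk
        rcases hk with rfl | hk
        · exact Or.inl rfl
        · exact Or.inr (Or.inl (by simp [e2, hk]))
      · intro k hk hks j hj
        rw [e1, List.mem_cons] at hj hks
        push Not at hks
        rcases hk with hk | hk | hk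
        · exact absurd hk hks.1
        · rcases hj with rfl | hj
          · exact e3 k hk
          · rw [e2, List.mem_append] at hk
            rw [e2, List.pairwise_append] at hto
            exact hto.2.2 j hj k (hk.resolve_left hks.2)
        · rcases hj with rfl | hj
          · have := hk.2; omega
          · have : j ∈ t := by simp [e2, hj]
            have := lt_sum this
            have := hk.2; omega
    · constructor
      · intro k hk
        exact ⟨Or.inr (Or.inl hk), a, Or.inl rfl, e3 k hk⟩
      · rintro k ⟨hk, y, hy, hyk⟩ hkt j hj
        have hjs := lt_sum hj
        rcases hk with rfl | hk | hk
        · exfalso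
          rcases hy with rfl | hy | hy
          · omega
          · have := e3 y hy; omega
          · have := hy.2; omega
        · exact absurd hk hkt
        · have := hk.2; omega
  rcases hC with hC | hC
  · left
    intro s hs t ht hsC htC hT
    obtain ⟨X, h1, h2, h3⟩ := key s hs t ht hsC htC hT
    exact h3.1 (hC X h1 h2)
  · right
    intro s hs t ht hsC htC hT
    obtain ⟨X, h1, h2, h3⟩ := key s hs t ht hsC htC hT
    exact fun hp => hC X h1 h2 (h3.2 hp)

variable {Q : Type} [Preorder Q]

theorem listLE_nil (t : List Q) : ListLE [] t :=
  ⟨fun i => i.elim0, fun i => i.elim0, fun i => i.elim0⟩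

theorem listLE_tail {s t : List Q} (h : ListLE s t.tail) : ListLE s t := by
  cases t with
  | nil => exact h
  | cons b t =>
    obtain ⟨g, hg, hg2⟩ := h
    refine ⟨fun i => Fin.succ (g i), fun i j hij => Fin.succ_lt_succ_iff.2 (hg hij), fun i => ?_⟩
    exact hg2 i

theorem listLE_cons {a b : Q} {s t : List Q} (hab : a ≤ b) (h : ListLE s t) :
    ListLE (a :: s) (b :: t) := by
  obtain ⟨g, hg, hg2⟩ := h
  refine ⟨fun i => Fin.cases (motive := fun _ => Fin (t.length + 1)) 0 (fun i => (g i).succ) i, ?_, ?_⟩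
  · intro i j
    refine Fin.cases ?_ (fun i => ?_) i <;> refine Fin.cases ?_ (fun j => ?_) j
    · intro h; exact absurd h (lt_irrefl _)
    · intro _; exact Fin.succ_pos _
    · intro h; exact absurd h (Fin.not_lt_zero _)
    · intro h; exact Fin.succ_lt_succ_iff.2 (hg (Fin.succ_lt_succ_iff.1 h))
  · intro i
    refine Fin.cases ?_ (fun i => ?_) i
    · exact hab
    · exact hg2 i

abbrev St (Q : Type) := Set ℕ × (List ℕ → List Q)

def Bad (B : Set (List ℕ)) (F : St Q) : Prop :=
  F.1 ⊆ base B ∧ F.1.Infinite ∧ ∀ s ∈ B, ∀ t ∈ B, (∀ k ∈ s, k ∈ F.1) → (∀ k ∈ t, k ∈ F.1) →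
    Tri s t → ¬ ListLE (F.2 s) (F.2 t)

def Le (B : Set (List ℕ)) (n : ℕ) (G F : St Q) : Prop :=
  G.1 ⊆ F.1 ∧ (∀ k < n, k ∈ F.1 → k ∈ G.1) ∧ ∀ s ∈ B, (∀ k ∈ s, k ∈ G.1) → G.2 s <:+ F.2 s

def Stable (B : Set (List ℕ)) (n : ℕ) (G : St Q) : Prop :=
  ∀ L : St Q, Bad B L → Le B n L G → ∀ s ∈ B, (∀ k ∈ s, k ∈ G.1 ∧ k < n) → L.2 s = G.2 s

theorem Le.refl (B : Set (List ℕ)) (n : ℕ) (F : St Q) : Le B n F F :=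
  ⟨subset_rfl, fun _ _ h => h, fun _ _ _ => List.suffix_rfl⟩

theorem Le.trans {B : Set (List ℕ)} {n : ℕ} {F G H : St Q} (h1 : Le B n F G) (h2 : Le B n G H) :
    Le B n F H :=
  ⟨h1.1.trans h2.1, fun k hk h => h1.2.1 k hk (h2.2.1 k hk h), fun s hs h =>
    (h1.2.2 s hs h).trans (h2.2.2 s hs (fun k hk => h1.1 (h k hk)))⟩

theorem Le.mono {B : Set (List ℕ)} {n m : ℕ} (hmn : m ≤ n) {F G : St Q} (h1 : Le B n F G) :
    Le B m F G :=
  ⟨h1.1, fun k hk h => h1.2.1 k (by omega) h, h1.2.2⟩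

open Classical in
theorem exists_stable {B : Set (List ℕ)} (hB : NB B) (n : ℕ) (F : St Q) (hF : Bad B F) :
    ∃ G, Bad B G ∧ Le B n G F ∧ Stable B n G := by
  let w : St Q → Finset ℕ → ℕ := fun G u =>
    if u.sort (· ≤ ·) ∈ B ∧ ∀ k ∈ u, k ∈ G.1 then (G.2 (u.sort (· ≤ ·))).length else 0
  let μ : St Q → ℕ := fun G => ∑ u ∈ (Finset.range n).powerset, w G u
  obtain ⟨G, ⟨hG1, hG2⟩, hmin⟩ := exists_minimalFor_of_wellFoundedLT
    (fun G : St Q => Bad B G ∧ Le B n G F) μ ⟨F, hF, Le.refl B n F⟩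
  refine ⟨G, hG1, hG2, fun L hL hLG s hs hsn => ?_⟩
  have hle : ∀ u ∈ (Finset.range n).powerset, w L u ≤ w G u := by
    intro u hu
    simp only [w]
    by_cases h : u.sort (· ≤ ·) ∈ B ∧ ∀ k ∈ u, k ∈ L.1
    · rw [if_pos h, if_pos ⟨h.1, fun k hk => hLG.1 (h.2 k hk)⟩]
      exact (hLG.2.2 _ h.1 (fun k hk => h.2 k (by simpa using hk))).length_le
    · rw [if_neg h]; exact Nat.zero_le _
  have hsum : μ L ≤ μ G := Finset.sum_le_sum hle
  have heq : μ L = μ G := le_antisymm hsum (hmin ⟨hL, hLG.trans hG2⟩ hsum)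
  have heq2 := (Finset.sum_eq_sum_iff_of_le hle).1 heq s.toFinset (by
    rw [Finset.mem_powerset]
    intro k hk
    rw [Finset.mem_range]
    exact (hsn k (by simpa using hk)).2)
  have hsort : s.toFinset.sort (· ≤ ·) = s :=
    sorted_ext (Finset.sortedLT_sort _).pairwise (hB.sorted s hs) (by simp)
  have hsL : ∀ k ∈ s, k ∈ L.1 := fun k hk => hLG.2.1 k (hsn k hk).2 (hsn k hk).1
  simp only [w, hsort] at heq2
  rw [if_pos ⟨hs, fun k hk => hsL k (by simpa using hk)⟩,
    if_pos ⟨hs, fun k hk => (hsn k (by simpa using hk)).1⟩] at heq2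
  exact (hLG.2.2 s hs hsL).eq_of_length heq2

theorem fusion {B : Set (List ℕ)} (hB : NB B) (F : St Q) (hF : Bad B F) :
    ∃ G : St Q, Bad B G ∧ ∀ a ∈ G.1, Stable B (a + 1) G := by
  let S := {F : St Q // Bad B F} × ℕ
  have hnext : ∀ q : S, ∃ r : S, Le B r.2 r.1.1 q.1.1 ∧ Stable B r.2 r.1.1 ∧
      ∃ a ∈ q.1.1.1, q.2 ≤ a ∧ r.2 = a + 1 ∧ ∀ k ∈ q.1.1.1, q.2 ≤ k → a ≤ k := by
    intro q
    have hne := (infinite_above q.1.2.2.1 q.2).nonempty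
    have hm := Nat.sInf_mem hne
    set a := sInf {k | k ∈ q.1.1.1 ∧ q.2 ≤ k} with ha
    obtain ⟨G, h1, h2, h3⟩ := exists_stable hB (a + 1) q.1.1 q.1.2
    exact ⟨(⟨G, h1⟩, a + 1), h2, h3, a, hm.1, hm.2, rfl, fun k hk hk2 => Nat.sInf_le ⟨hk, hk2⟩⟩
  choose nx hx1 hx2 α hα1 hα2 hα3 hα4 using hnext
  let q : ℕ → S := fun i => Nat.rec (⟨F, hF⟩, 0) (fun _ q => nx q) i
  have hq : ∀ i, q (i + 1) = nx (q i) := fun i => rfl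
  let A : ℕ → Set ℕ := fun i => (q i).1.1.1
  let f : ℕ → List ℕ → List Q := fun i => (q i).1.1.2
  let n : ℕ → ℕ := fun i => (q i).2
  let a : ℕ → ℕ := fun i => α (q i)
  have hbad : ∀ i, Bad B (A i, f i) := fun i => (q i).1.2
  have hn : ∀ i, n (i + 1) = a i + 1 := fun i => hα3 (q i)
  have ha1 : ∀ i, a i ∈ A i := fun i => hα1 (q i)
  have ha2 : ∀ i, n i ≤ a i := fun i => hα2 (q i)
  have ha3 : ∀ i, ∀ k ∈ A i, n i ≤ k → a i ≤ k := fun i => hα4 (q i)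
  have hst : ∀ i, Stable B (n (i + 1)) (A (i + 1), f (i + 1)) := fun i => hx2 (q i)
  have hle1 : ∀ i, Le B (n (i + 1)) (A (i + 1), f (i + 1)) (A i, f i) := fun i => hx1 (q i)
  have hn0 : n 0 = 0 := rfl
  clear_value A f n a
  have hnm : StrictMono n := strictMono_nat_of_lt_succ (fun i => by
    have := hn i; have := ha2 i; omega)
  have hle : ∀ i j, i ≤ j → Le B (n i) (A j, f j) (A i, f i) := by
    intro i j hij
    induction j, hij using Nat.le_induction with
    | base => exact Le.refl _ _ _
    | succ j hij ih =>
      exact ((hle1 j).mono (hnm.monotone (by omega))).trans ih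
  let A' : Set ℕ := {k | ∀ i, k ∈ A i}
  let f' : List ℕ → List Q := fun s => f (s.sum + 1) s
  have haA : ∀ i, a i ∈ A' := by
    intro i j
    rcases le_total i j with hij | hij
    · rcases Nat.eq_or_lt_of_le hij with rfl | hij
      · exact ha1 i
      · have h1 : a i ∈ A (i + 1) := (hle1 i).2.1 (a i) (by have := hn i; omega) (ha1 i)
        exact (hle (i + 1) j hij).2.1 (a i) (by have := hn i; omega) h1
    · exact (hle j i hij).1 (ha1 i)
  have ham : StrictMono a := strictMono_nat_of_lt_succ (fun i => by
    have := hn i; have := ha2 (i + 1); omega)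
  -- values stabilise
  have hval : ∀ i, ∀ s ∈ B, (∀ k ∈ s, k ∈ A') → (∀ k ∈ s, k < n (i + 1)) →
      ∀ j, i + 1 ≤ j → f j s = f (i + 1) s := by
    intro i s hs hsA hsn j hij
    exact hst i (A j, f j) (hbad j) (hle _ _ hij) s hs (fun k hk => ⟨hsA k hk _, hsn k hk⟩)
  have hval' : ∀ s ∈ B, (∀ k ∈ s, k ∈ A') → ∀ j, s.sum + 1 ≤ j → f j s = f' s := by
    intro s hs hsA j hj
    refine hval s.sum s hs hsA (fun k hk => ?_) j hj
    have h1 := lt_sum hk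
    have h2 : s.sum + 1 ≤ n (s.sum + 1) := hnm.id_le _
    omega
  have hbad' : Bad B (A', f') := by
    refine ⟨fun k hk => (hbad 0).1 (hk 0), ?_, ?_⟩
    · exact (Set.infinite_range_of_injective ham.injective).mono (by rintro _ ⟨i, rfl⟩; exact haA i)
    · intro s hs t ht hsA htA hT
      have := (hbad (s.sum + t.sum + 1)).2.2 s hs t ht (fun k hk => hsA k hk _)
        (fun k hk => htA k hk _) hT
      simp only at this
      rw [hval' s hs hsA _ (by omega), hval' t ht htA _ (by omega)] at this
      exact this
  refine ⟨(A', f'), hbad', ?_⟩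
  intro x hx L hL hLe s hs hsx
  simp only at hx hsx ⊢
  -- find i with x = a i
  obtain ⟨i, hi⟩ : ∃ i, x = a i := by
    have hex : ∃ i, x < n i := ⟨x + 1, lt_of_lt_of_le (Nat.lt_succ_self x) (hnm.id_le _)⟩
    classical
    have h1 := Nat.find_spec hex
    obtain ⟨i, hi⟩ : ∃ i, Nat.find hex = i + 1 :=
      Nat.exists_eq_succ_of_ne_zero (fun h0 => by rw [h0, hn0] at h1; omega)
    have h2 : ¬ x < n i := Nat.find_min hex (by omega)
    rw [hi, hn] at h1
    have := ha3 i x (hx i) (by omega)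
    exact ⟨i, by omega⟩
  have hn' : n (i + 1) = x + 1 := by rw [hn, hi]
  have hsA : ∀ k ∈ s, k ∈ A' := fun k hk => (hsx k hk).1
  have e1 : f' s = f (i + 1) s := by
    have h1 := hval i s hs hsA (fun k hk => by rw [hn']; exact (hsx k hk).2)
      (max (i + 1) (s.sum + 1)) (le_max_left _ _)
    rw [← h1, hval' s hs hsA _ (le_max_right _ _)]
  rw [e1]
  refine hst i L hL ?_ s hs (fun k hk => ⟨hsA k hk _, by rw [hn']; exact (hsx k hk).2⟩)
  rw [hn']
  refine hLe.trans ⟨fun k hk => hk _, ?_, ?_⟩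
  · intro k hk hkA j
    rcases le_total (i + 1) j with hij | hij
    · exact (hle _ _ hij).2.1 k (by omega) hkA
    · exact (hle _ _ hij).1 hkA
  · intro t ht htA
    have h1 := (hle (i + 1) (max (i + 1) (t.sum + 1)) (le_max_left _ _)).2.2 t ht
      (fun k hk => htA k hk _)
    simp only at h1
    rw [hval' t ht htA _ (le_max_right _ _)] at h1
    exact h1

open Classical in
theorem no_bad {B : Set (List ℕ)} (hB : NB B)
    (hQ : ∀ B : Set (List ℕ), IsBarrier B → ∀ f : List ℕ → Q,
      ∃ s ∈ B, ∃ t ∈ B, Tri s t ∧ f s ≤ f t)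
    (hres : ∀ C ⊆ base B, C.Infinite → IsBarrier {s | s ∈ B ∧ ∀ k ∈ s, k ∈ C})
    (F : St Q) (hF : Bad B F) : False := by
  obtain ⟨⟨A, f⟩, ⟨hAB, hAi, hbad⟩, hstab⟩ := fusion hB F hF
  simp only at hAB hAi hbad hstab
  have hne : ∀ s ∈ B, (∀ k ∈ s, k ∈ A) → f s ≠ [] := by
    intro s hs hsA h0
    obtain ⟨t, ht, htA, hT⟩ := hB.exists_succ hAi hAB hs hsA
    apply hbad s hs t ht hsA htA hT
    rw [h0]; exact listLE_nil _
  obtain ⟨s0, hs0, hs0i⟩ := hB.bar A hAB hAi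
  obtain ⟨q0, l0, hq0⟩ := List.exists_cons_of_ne_nil (hne s0 hs0 hs0i.1)
  let hd : List ℕ → Q := fun s => (f s).headD q0
  have hdec : ∀ s ∈ B, (∀ k ∈ s, k ∈ A) → f s = hd s :: (f s).tail := by
    intro s hs hsA
    obtain ⟨x, l, hx⟩ := List.exists_cons_of_ne_nil (hne s hs hsA)
    simp [hd, hx]
  obtain ⟨C, hCA, hCi, hC⟩ := hB.ramsey hAi hAB (fun s t => hd s ≤ hd t)
  rcases hC with hC | hC
  swap
  · obtain ⟨s, hs, t, ht, hT, hle⟩ := hQ _ (hres C (hCA.trans hAB) hCi) hd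
    exact hC s hs.1 t ht.1 hs.2 ht.2 hT hle
  have htail : ∀ s ∈ B, ∀ t ∈ B, (∀ k ∈ s, k ∈ C) → (∀ k ∈ t, k ∈ C) → Tri s t →
      ¬ ListLE (f s).tail (f t).tail := by
    intro s hs t ht hsC htC hT hle
    apply hbad s hs t ht (fun k hk => hCA (hsC k hk)) (fun k hk => hCA (htC k hk)) hT
    rw [hdec s hs (fun k hk => hCA (hsC k hk)), hdec t ht (fun k hk => hCA (htC k hk))]
    exact listLE_cons (hC s hs t ht hsC htC hT) hle
  -- minimal cut-off
  have hex : ∃ p, ∃ s ∈ B, (∀ k ∈ s, k ∈ C) ∧ ∀ k ∈ s, k < p + 1 := by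
    obtain ⟨s, hs, hi⟩ := hB.bar C (hCA.trans hAB) hCi
    exact ⟨s.sum, s, hs, hi.1, fun k hk => lt_sum hk⟩
  obtain ⟨s, hs, hsC, hsp⟩ := Nat.find_spec hex
  have hmin : ∀ p < Nat.find hex, _ := fun p hp => Nat.find_min hex hp
  set p := Nat.find hex with hp
  have hbig : ∀ t ∈ B, (∀ k ∈ t, k ∈ C) → ∃ k ∈ t, p ≤ k := by
    intro t ht htC
    by_contra hcon
    push Not at hcon
    have hl := hB.len t ht
    obtain ⟨x, hx⟩ : ∃ x, x ∈ t := List.exists_mem_of_length_pos (by omega)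
    have := hcon x hx
    refine hmin (p - 1) (by omega) ⟨t, ht, htC, fun k hk => ?_⟩
    have := hcon k hk
    omega
  have hpA : p ∈ A := by
    obtain ⟨k, hk, hpk⟩ := hbig s hs hsC
    have := hsp k hk
    have : k = p := by omega
    exact this ▸ hCA (hsC k hk)
  let D : Set ℕ := {k | (k ∈ A ∧ k < p + 1) ∨ (k ∈ C ∧ p + 1 ≤ k)}
  have hDA : D ⊆ A := by
    rintro k (hk | hk)
    · exact hk.1
    · exact hCA hk.1
  let g : List ℕ → List Q := fun t => if ∀ k ∈ t, k ∈ C then (f t).tail else f t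
  have hDbad : Bad B ((D, g) : St Q) := by
    refine ⟨hDA.trans hAB, (infinite_above hCi (p + 1)).mono (fun k hk => Or.inr hk), ?_⟩
    intro u hu v hv huD hvD hT
    simp only at huD hvD ⊢
    have hb := hbad u hu v hv (fun k hk => hDA (huD k hk)) (fun k hk => hDA (hvD k hk)) hT
    by_cases huC : ∀ k ∈ u, k ∈ C
    · have hvC : ∀ k ∈ v, k ∈ C := by
        obtain ⟨a, u', r, e1, e2, e3⟩ := hB.tri hu hv hT
        have hvs := hB.sorted v hv
        intro k hk
        have hk' := hk
        rw [e2, List.mem_append] at hk'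
        rcases hk' with hk' | hk'
        · exact huC k (by simp [e1, hk'])
        · obtain ⟨x, hx, hpx⟩ := hbig u hu huC
          have hxk : x < k := by
            rw [e1, List.mem_cons] at hx
            rcases hx with rfl | hx
            · exact e3 k hk
            · rw [e2, List.pairwise_append] at hvs
              exact hvs.2.2 x hx k hk'
          rcases hvD k hk with h | h
          · omega
          · exact h.1
      simp only [g, if_pos huC, if_pos hvC]
      exact htail u hu v hv huC hvC hT
    · by_cases hvC : ∀ k ∈ v, k ∈ C
      · simp only [g, if_neg huC, if_pos hvC]
        exact fun h => hb (listLE_tail h)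
      · simp only [g, if_neg huC, if_neg hvC]
        exact hb
  have hDle : Le B (p + 1) ((D, g) : St Q) (A, f) := by
    refine ⟨hDA, fun k hk hkA => Or.inl ⟨hkA, hk⟩, fun t ht htD => ?_⟩
    simp only [g]
    split_ifs
    · exact List.tail_suffix _
    · exact List.suffix_rfl
  have hfin := hstab p hpA (D, g) hDbad hDle s hs (fun k hk => ⟨hCA (hsC k hk), hsp k hk⟩)
  simp only [g, if_pos hsC] at hfin
  have hd1 := hdec s hs (fun k hk => hCA (hsC k hk))
  have := congrArg List.length hfin
  have h2 := congrArg List.length hd1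
  simp at h2 this
  omega

theorem restrict {B : Set (List ℕ)} (hB : IsBarrier B) (C : Set ℕ) (hC : C ⊆ base B)
    (hCi : C.Infinite) (hlen : ∀ s ∈ B, s ≠ []) :
    IsBarrier {s | s ∈ B ∧ ∀ k ∈ s, k ∈ C} := by
  have hb : base {s | s ∈ B ∧ ∀ k ∈ s, k ∈ C} = C := by
    ext x
    constructor
    · rintro ⟨s, hs, hx⟩
      exact hs.2 x hx
    · intro hx
      let X : Set ℕ := {k | k ∈ C ∧ x ≤ k}
      obtain ⟨s, hs, hi⟩ := bar_of_barrier hB X (fun k hk => hC hk.1) (infinite_above hCi x)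
      refine ⟨s, ⟨hs, fun k hk => (hi.1 k hk).1⟩, ?_⟩
      by_contra hxs
      obtain ⟨y, hy⟩ := List.exists_mem_of_ne_nil s (hlen s hs)
      have h1 := hi.2 x ⟨hx, le_rfl⟩ hxs y hy
      have h2 := (hi.1 y hy).2
      omega
  refine ⟨fun s hs => hB.1 s hs.1, by rw [hb]; exact hCi, ?_, fun s hs t ht => hB.2.2.2 s hs.1 t ht.1⟩
  rw [hb]
  intro e he hee
  obtain ⟨k, hk⟩ := hB.2.2.1 e he (fun n => hC (hee n))
  refine ⟨k, hk, ?_⟩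
  intro j hj
  simp only [List.mem_map] at hj
  obtain ⟨i, _, rfl⟩ := hj
  exact hee i

theorem main
    (hQ : ∀ B : Set (List ℕ), IsBarrier B → ∀ f : List ℕ → Q,
      ∃ s ∈ B, ∃ t ∈ B, Tri s t ∧ f s ≤ f t) :
    ∀ B : Set (List ℕ), IsBarrier B → ∀ f : List ℕ → List Q,
      ∃ s ∈ B, ∃ t ∈ B, Tri s t ∧ ListLE (f s) (f t) := by
  intro B hB f
  by_contra hcon
  push Not at hcon
  have hnil : ∀ s ∈ B, s ≠ [] := by
    rintro s hs rfl
    apply hB.2.1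
    have : base B = ∅ := by
      ext x
      simp only [Set.mem_empty_iff_false, iff_false]
      rintro ⟨t, ht, hx⟩
      have := hB.2.2.2 [] hs t ht (by simp) x hx
      simp at this
    rw [this]; exact Set.finite_empty
  have hN : NB B := by
    refine ⟨fun s hs => List.isChain_iff_pairwise.1 (hB.1 s hs), bar_of_barrier hB, hB.2.2.2, ?_⟩
    intro s hs
    match s, hs with
    | [], hs => exact absurd rfl (hnil _ hs)
    | [a], hs =>
      exfalso
      exact hcon [a] hs [a] hs ⟨[a, a], by simp, by simp⟩
        ⟨id, strictMono_id, fun i => le_rfl⟩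
    | a :: b :: s, hs => simp
  exact no_bad hN hQ (fun C hC hCi => restrict hB C hC hCi hnil) (base B, f)
    ⟨subset_rfl, hB.2.1, fun s hs t ht _ _ hT => hcon s hs t ht hT⟩

end GHT

/-- Generalized Higman theorem: if `Q` is bqo then `Q^{<ω}` (finite sequences
under embeddability) is bqo. -/
theorem stmt_12 {Q : Type} [Preorder Q]
    (hQ : ∀ B : Set (List ℕ), IsBarrier B → ∀ f : List ℕ → Q,
      ∃ s ∈ B, ∃ t ∈ B, Tri s t ∧ f s ≤ f t) :
    ∀ B : Set (List ℕ), IsBarrier B → ∀ f : List ℕ → List Q,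
      ∃ s ∈ B, ∃ t ∈ B, Tri s t ∧ ListLE (f s) (f t) :=
  GHT.main hQ
end

section
/- Nash-Williams' theorem (NWT): If (Q, ⪯) is a bqo then the class Q̃ of countable transfinite sequences of elements of Q (functions from countable ordinals to Q), quasi-ordered by embeddability, is a bqo: every map from a barrier into Q̃ is good. -/
/-- A transfinite sequence of elements of `Q`: a length (an ordinal) together
with a function giving the terms (values at or beyond `len` are irrelevant). -/
structure TSeq (Q : Type) where
  len : Ordinal
  f : Ordinal → Q

/-- Embeddability of transfinite sequences: a strictly increasing map of the
index ordinals under which terms grow. -/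
def TSeq.Emb {Q : Type} [Preorder Q] (σ τ : TSeq Q) : Prop :=
  ∃ g : Ordinal → Ordinal,
    (∀ β, β < σ.len → g β < τ.len) ∧
    (∀ β γ, β < γ → γ < σ.len → g β < g γ) ∧
    (∀ β, β < σ.len → σ.f β ≤ τ.f (g β))

/-- `τ = Σₙ σₙ`, the infinite concatenation of the `σₙ`. -/
def IsConcat {Q : Type} (τ : TSeq Q) (σs : ℕ → TSeq Q) : Prop :=
  ∃ g : ℕ → Ordinal, g 0 = 0 ∧ (∀ n, g (n + 1) = g n + (σs n).len) ∧
    τ.len = ⨆ n, g n ∧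
    ∀ n, ∀ β, β < (σs n).len → τ.f (g n + β) = (σs n).f β

/-- `ρ = Σ_{n < k} σₙ`, the concatenation of the first `k` of the `σₙ`. -/
def IsFinConcat {Q : Type} (ρ : TSeq Q) (σs : ℕ → TSeq Q) (k : ℕ) : Prop :=
  ∃ g : ℕ → Ordinal, g 0 = 0 ∧ (∀ n, n < k → g (n + 1) = g n + (σs n).len) ∧
    ρ.len = g k ∧
    ∀ n, n < k → ∀ β, β < (σs n).len → ρ.f (g n + β) = (σs n).f β

/-- `⟨σₙ⟩` is quasi-monotonic: every term embeds into a later term. -/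
def QuasiMonotonic {Q : Type} [Preorder Q] (σs : ℕ → TSeq Q) : Prop :=
  ∀ n, ∃ m, n < m ∧ TSeq.Emb (σs n) (σs m)

/-- The class `H` of hereditarily indecomposable sequences: sequences of length 1,
closed under quasi-monotonic infinite concatenations. -/
inductive InH {Q : Type} [Preorder Q] : TSeq Q → Prop
  | single (σ : TSeq Q) : σ.len = 1 → InH σ
  | concat (τ : TSeq Q) (σs : ℕ → TSeq Q) :
      (∀ n, InH (σs n)) → QuasiMonotonic σs → IsConcat τ σs → InH τ

namespace NW

def tl (X : Set ℕ) : Set ℕ := X \ {sInf X}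

theorem tl_sub (X : Set ℕ) : tl X ⊆ X := Set.sdiff_subset

theorem tl_inf {X : Set ℕ} (h : X.Infinite) : (tl X).Infinite :=
  h.sdiff (Set.finite_singleton _)

def Loc {S : Type*} (A : Set ℕ) (F : Set ℕ → S) : Prop :=
  ∀ X ⊆ A, X.Infinite → ∃ k : ℕ, ∀ Y ⊆ A, Y.Infinite → (∀ i ≤ k, i ∈ Y ↔ i ∈ X) → F Y = F X

structure Arr {S : Type*} (le : S → S → Prop) (A : Set ℕ) (F : Set ℕ → S) : Prop where
  inf : A.Infinite
  loc : Loc A F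
  bad : ∀ X ⊆ A, X.Infinite → ¬ le (F X) (F (tl X))

theorem Loc.mono {S : Type*} {A C : Set ℕ} {F : Set ℕ → S} (h : Loc A F) (hC : C ⊆ A) :
    Loc C F := by
  intro X hX hi
  obtain ⟨k, hk⟩ := h X (hX.trans hC) hi
  exact ⟨k, fun Y hY => hk Y (hY.trans hC)⟩

theorem Arr.mono {S : Type*} {le : S → S → Prop} {A C : Set ℕ} {F : Set ℕ → S} (h : Arr le A F)
    (hC : C ⊆ A) (hi : C.Infinite) : Arr le C F :=
  ⟨hi, h.loc.mono hC, fun X hX => h.bad X (hX.trans hC)⟩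

structure Redn {S : Type*} (le lt : S → S → Prop) (A : Set ℕ) (F : Set ℕ → S)
    (A' : Set ℕ) (F' : Set ℕ → S) : Prop where
  sub : A' ⊆ A
  arr : Arr le A' F'
  lt : ∀ X ⊆ A', X.Infinite → lt (F' X) (F X)

structure At {S : Type*} (le lt : S → S → Prop) (A : Set ℕ) (F : Set ℕ → S)
    (A' : Set ℕ) (F' : Set ℕ → S) (k : ℕ) (s : Set ℕ) : Prop where
  red : Redn le lt A F A' F'
  ss : s ⊆ A'
  ks : k ∈ s
  sk : ∀ i ∈ s, i ≤ k
  dec : ∃ v, (∀ Y ⊆ A', Y.Infinite → (∀ i ≤ k, i ∈ Y ↔ i ∈ s) → F Y = v) ∨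
    (∀ Y ⊆ A', Y.Infinite → (∀ i ≤ k, i ∈ Y ↔ i ∈ s) → F' Y = v)

def mA (A A' : Set ℕ) (k : ℕ) : Set ℕ := {i | (i ∈ A ∧ i ≤ k) ∨ (i ∈ A' ∧ k < i)}

open Classical in
noncomputable def mF {S : Type*} (F : Set ℕ → S) (A' : Set ℕ) (F' : Set ℕ → S) : Set ℕ → S :=
  fun X => if X ⊆ A' then F' X else F X

theorem inf_ex {X : Set ℕ} (h : X.Infinite) (j : ℕ) : ∃ M ∈ X, j ≤ M := by
  obtain ⟨M, hM, h1⟩ := h.exists_gt j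
  exact ⟨M, hM, h1.le⟩

theorem inf_gt {X : Set ℕ} (h : X.Infinite) (j : ℕ) : {i | i ∈ X ∧ j < i}.Infinite := by
  have := h.sdiff (Set.finite_Iic j)
  refine this.mono ?_
  rintro x ⟨h1, h2⟩
  exact ⟨h1, by simpa using h2⟩

theorem merge_arr {S : Type*} {le lt : S → S → Prop} (htr : ∀ a b c, le a b → le b c → le a c)
    (hlt : ∀ a b, lt a b → le a b) {A A' : Set ℕ} {F F' : Set ℕ → S} (h : Arr le A F)
    (hr : Redn le lt A F A' F') (k : ℕ) : Arr le (mA A A' k) (mF F A' F') := by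
  have hsub : mA A A' k ⊆ A := by
    rintro i (hi | hi)
    · exact hi.1
    · exact hr.sub hi.1
  refine ⟨?_, ?_, ?_⟩
  · exact (inf_gt hr.arr.inf k).mono fun i hi => Or.inr hi
  · intro X hX hi
    by_cases hXA : X ⊆ A'
    · obtain ⟨j, hj⟩ := hr.arr.loc X hXA hi
      refine ⟨max j k, fun Y hY hYi hp => ?_⟩
      have hYA : Y ⊆ A' := by
        intro i hiY
        by_cases hik : i ≤ k
        · exact hXA ((hp i (le_max_of_le_right hik)).1 hiY)
        · rcases hY hiY with h1 | h1
          · exact absurd h1.2 hik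
          · exact h1.1
      simp only [mF, hXA, hYA, if_true]
      exact hj Y hYA hYi fun i hi => hp i (le_max_of_le_left hi)
    · obtain ⟨j, hj⟩ := h.loc X (hX.trans hsub) hi
      refine ⟨max j k, fun Y hY hYi hp => ?_⟩
      have hYA : ¬ Y ⊆ A' := by
        obtain ⟨x, hx, hxA⟩ := Set.not_subset.1 hXA
        intro hh
        apply hxA
        rcases hX hx with h1 | h1
        · exact hh ((hp x (le_max_of_le_right h1.2)).2 hx)
        · exact h1.1
      simp only [mF, hXA, hYA, if_false]
      exact hj Y (hY.trans hsub) hYi fun i hi => hp i (le_max_of_le_left hi)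
  · intro X hX hi
    by_cases hXA : X ⊆ A'
    · have : tl X ⊆ A' := (tl_sub X).trans hXA
      simp only [mF, hXA, this, if_true]
      exact hr.arr.bad X hXA hi
    · by_cases ht : tl X ⊆ A'
      · simp only [mF, hXA, ht, if_true, if_false]
        intro hh
        exact h.bad X (hX.trans hsub) hi (htr _ _ _ hh (hlt _ _ (hr.lt _ ht (tl_inf hi))))
      · simp only [mF, hXA, ht, if_false]
        exact h.bad X (hX.trans hsub) hi

theorem exists_min_at {S : Type*} {le lt : S → S → Prop}
    (hred : ∀ A F, Arr le A F → ∃ A' F', Redn le lt A F A' F')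
    (A : Set ℕ) (F : Set ℕ → S) (h : Arr le A F) :
    ∃ A' F' k s, At le lt A F A' F' k s ∧
      ∀ A'' F'' k' s', At le lt A F A'' F'' k' s' → k ≤ k' := by
  have hex : ∃ k, ∃ A' F' s, At le lt A F A' F' k s := by
    obtain ⟨A', F', hr⟩ := hred A F h
    obtain ⟨j, hj⟩ := hr.arr.loc A' subset_rfl hr.arr.inf
    obtain ⟨M, hM, hjM⟩ := inf_ex hr.arr.inf j
    refine ⟨M, A', F', {i | i ∈ A' ∧ i ≤ M}, hr, fun i hi => hi.1, ⟨hM, le_rfl⟩, fun i hi => hi.2,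
      F' A', Or.inr fun Y hY hYi hp => hj Y hY hYi fun i hi => ?_⟩
    rw [hp i (hi.trans hjM)]
    exact ⟨fun h => h.1, fun h => ⟨h, hi.trans hjM⟩⟩
  classical
  obtain ⟨A', F', s, hs⟩ := Nat.find_spec hex
  exact ⟨A', F', _, s, hs, fun A'' F'' k' s' h' => Nat.find_min' hex ⟨A'', F'', s', h'⟩⟩

theorem no_bad {S : Type*} {le lt : S → S → Prop} (htr : ∀ a b c, le a b → le b c → le a c)
    (hlt : ∀ a b, lt a b → le a b) (hltr : ∀ a b c, lt a b → lt b c → lt a c)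
    (wf : WellFounded lt)
    (hred : ∀ A F, Arr le A F → ∃ A' F', Redn le lt A F A' F')
    (A₀ : Set ℕ) (F₀ : Set ℕ → S) (h₀ : Arr le A₀ F₀) : False := by
  have irr : ∀ a, ¬ lt a a := fun a h => wf.irrefl.irrefl a h
  -- build the sequence
  obtain ⟨A, F, A', F', k, s, hA, hAt, hmin, hAs, hFs⟩ :
      ∃ (A : ℕ → Set ℕ) (F : ℕ → Set ℕ → S) (A' : ℕ → Set ℕ) (F' : ℕ → Set ℕ → S) (k : ℕ → ℕ)
        (s : ℕ → Set ℕ), (∀ n, Arr le (A n) (F n)) ∧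
        (∀ n, At le lt (A n) (F n) (A' n) (F' n) (k n) (s n)) ∧
        (∀ n A'' F'' k' s', At le lt (A n) (F n) A'' F'' k' s' → k n ≤ k') ∧
        (∀ n, A (n+1) = mA (A n) (A' n) (k n)) ∧ (∀ n, F (n+1) = mF (F n) (A' n) (F' n)) := by
    choose cA cF ck cs hc hcm using exists_min_at hred
    let St := {p : Set ℕ × (Set ℕ → S) // Arr le p.1 p.2}
    let nxt : St → St := fun p => ⟨(mA p.1.1 (cA _ _ p.2) (ck _ _ p.2),
      mF p.1.2 (cA _ _ p.2) (cF _ _ p.2)), merge_arr htr hlt p.2 (hc _ _ p.2).red _⟩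
    let sq : ℕ → St := fun n => nxt^[n] ⟨(A₀, F₀), h₀⟩
    have hsq : ∀ n, sq (n+1) = nxt (sq n) := fun n => Function.iterate_succ_apply' _ _ _
    refine ⟨fun n => (sq n).1.1, fun n => (sq n).1.2, fun n => cA _ _ (sq n).2,
      fun n => cF _ _ (sq n).2, fun n => ck _ _ (sq n).2, fun n => cs _ _ (sq n).2,
      fun n => (sq n).2, fun n => hc _ _ _, fun n => hcm _ _ _, fun n => ?_, fun n => ?_⟩
    · simp only [hsq]; rfl
    · simp only [hsq]; rfl
  clear h₀
  have mem_succ : ∀ n i, i ∈ A (n+1) ↔ (i ∈ A n ∧ i ≤ k n) ∨ (i ∈ A' n ∧ k n < i) := by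
    intro n i; rw [hAs]; rfl
  have Fin : ∀ n X, X ⊆ A' n → F (n+1) X = F' n X := by
    intro n X h; rw [hFs]; simp [mF, h]
  have Fout : ∀ n X, ¬ X ⊆ A' n → F (n+1) X = F n X := by
    intro n X h; rw [hFs]; simp [mF, h]
  have hAsub : ∀ n, A (n+1) ⊆ A n := by
    intro n i hi
    rcases (mem_succ n i).1 hi with h | h
    · exact h.1
    · exact (hAt n).red.sub h.1
  have hanti : ∀ n m, n ≤ m → A m ⊆ A n := by
    intro n m h
    induction m, h using Nat.le_induction with
    | base => exact subset_rfl
    | succ m _ ih => exact (hAsub m).trans ih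
  have hFle : ∀ n m, n ≤ m → ∀ X ⊆ A m, X.Infinite → F m X = F n X ∨ lt (F m X) (F n X) := by
    intro n m h
    induction m, h using Nat.le_induction with
    | base => intro X _ _; exact Or.inl rfl
    | succ m _ ih =>
      intro X hX hi
      have h1 := ih X (hX.trans (hAsub m)) hi
      by_cases hXA : X ⊆ A' m
      · rw [Fin m X hXA]
        have h2 := (hAt m).red.lt X hXA hi
        rcases h1 with h1 | h1
        · rw [← h1]; exact Or.inr h2
        · exact Or.inr (hltr _ _ _ h2 h1)
      · rw [Fout m X hXA]; exact h1
  have hRed : ∀ n m, n ≤ m → ∀ C G, Redn le lt (A m) (F m) C G → Redn le lt (A n) (F n) C G := by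
    intro n m h C G hr
    refine ⟨hr.sub.trans (hanti n m h), hr.arr, fun X hX hi => ?_⟩
    have h1 := hr.lt X hX hi
    rcases hFle n m h X (hX.trans hr.sub) hi with h2 | h2
    · rwa [← h2]
    · exact hltr _ _ _ h1 h2
  -- monotonicity of k
  have hkm1 : ∀ n, k n ≤ k (n+1) := by
    intro n
    by_contra hlt'
    push Not at hlt'
    apply absurd _ (not_le.2 hlt')
    have a1 := hAt (n+1)
    obtain ⟨v, hv | hv⟩ := a1.dec
    · by_cases hs : s (n+1) ⊆ A' n
      · set C : Set ℕ := {i | i ∈ A' (n+1) ∧ (i ∈ s (n+1) ∨ k n < i)} with hC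
        have hCi : C.Infinite := (inf_gt a1.red.arr.inf (k n)).mono fun i hi => ⟨hi.1, Or.inr hi.2⟩
        have hCA : C ⊆ A' n := by
          rintro i ⟨h1, h2 | h2⟩
          · exact hs h2
          · rcases (mem_succ n i).1 (a1.red.sub h1) with h3 | h3
            · exact absurd h3.2 (not_le.2 h2)
            · exact h3.1
        refine hmin n C (F' n) (k (n+1)) (s (n+1)) ⟨⟨?_, ?_, ?_⟩, ?_, a1.ks, a1.sk, v, Or.inr ?_⟩
        · exact hCA.trans (hAt n).red.sub
        · exact (hAt n).red.arr.mono hCA hCi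
        · exact fun X hX hi => (hAt n).red.lt X (hX.trans hCA) hi
        · exact fun i hi => ⟨a1.ss hi, Or.inl hi⟩
        · intro Y hY hYi hp
          rw [← Fin n Y (hY.trans hCA)]
          exact hv Y (hY.trans fun i hi => hi.1) hYi hp
      · refine hmin n (A' (n+1)) (F' (n+1)) (k (n+1)) (s (n+1))
          ⟨hRed n (n+1) (Nat.le_succ n) _ _ a1.red, a1.ss, a1.ks, a1.sk, v, Or.inl ?_⟩
        intro Y hY hYi hp
        rw [← hv Y hY hYi hp, Fout]
        intro hh
        exact hs fun i hi => hh ((hp i (a1.sk i hi)).2 hi)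
    · exact hmin n _ _ _ (s (n+1))
        ⟨hRed n (n+1) (Nat.le_succ n) _ _ a1.red, a1.ss, a1.ks, a1.sk, v, Or.inr hv⟩
  have hkm : Monotone k := monotone_nat_of_le_succ hkm1
  -- unboundedness of k
  have hkub : ∀ M, ∃ n, M < k n := by
    by_contra hcon
    push Not at hcon
    obtain ⟨M, hM⟩ := hcon
    have hfin : {t : Set ℕ | t ⊆ Set.Iic M}.Finite := (Set.finite_Iic M).finite_subsets
    have : Finite {t : Set ℕ | t ⊆ Set.Iic M} := hfin
    obtain ⟨⟨t, ht⟩, hinf⟩ := Finite.exists_infinite_fiber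
      (fun n => (⟨s n, fun i hi => ((hAt n).sk i hi).trans (hM n)⟩ : {t : Set ℕ | t ⊆ Set.Iic M}))
    rw [Set.infinite_coe_iff] at hinf
    set I : Set ℕ := {n | s n = t} with hI
    have hIinf : I.Infinite := by
      refine hinf.mono ?_
      intro n hn
      exact Subtype.ext_iff.1 hn
    have hkk : ∀ n ∈ I, ∀ m ∈ I, k n = k m := by
      intro n hn m hm
      apply le_antisymm
      · apply (hAt m).sk; rw [show s m = t from hm, ← show s n = t from hn]; exact (hAt n).ks
      · apply (hAt n).sk; rw [show s n = t from hn, ← show s m = t from hm]; exact (hAt m).ks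
    choose v hv using fun n => (hAt n).dec
    have key : ∀ n ∈ I, ∀ m ∈ I, n < m → ∀ Y ⊆ A' m, (∀ i ≤ k m, i ∈ Y ↔ i ∈ t) → Y ⊆ A' n := by
      intro n hn m hm hnm Y hY hp i hi
      by_cases hik : i ≤ k m
      · have := (hp i hik).1 hi
        rw [← show s n = t from hn] at this
        exact (hAt n).ss this
      · rcases (mem_succ n i).1 (hanti (n+1) m hnm ((hAt m).red.sub (hY hi))) with h3 | h3
        · rw [hkk n hn m hm] at h3; exact absurd h3.2 hik
        · exact h3.1
    have hdesc : ∀ n ∈ I, ∀ m ∈ I, ∀ l ∈ I, n < m → m < l → lt (v l) (v n) := by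
      intro n hn m hm l hl hnm hml
      set Y : Set ℕ := {i | i ∈ A' l ∧ (i ∈ t ∨ k l < i)} with hYd
      have hYi : Y.Infinite := (inf_gt (hAt l).red.arr.inf (k l)).mono fun i hi => ⟨hi.1, Or.inr hi.2⟩
      have hYl : Y ⊆ A' l := fun i hi => hi.1
      have hpl : ∀ i ≤ k l, i ∈ Y ↔ i ∈ t := by
        intro i hi
        refine ⟨fun h => h.2.resolve_right (not_lt.2 hi), fun h => ⟨?_, Or.inl h⟩⟩
        rw [← show s l = t from hl] at h
        exact (hAt l).ss h
      have hYm := key m hm l hl hml Y hYl hpl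
      have hpm : ∀ i ≤ k m, i ∈ Y ↔ i ∈ t := by rw [hkk m hm l hl]; exact hpl
      have hpn : ∀ i ≤ k n, i ∈ Y ↔ i ∈ t := by rw [hkk n hn l hl]; exact hpl
      have hYn := key n hn m hm hnm Y hYm hpm
      have e1 : v l = F l Y ∨ lt (v l) (F l Y) := by
        rcases hv l with h | h
        · exact Or.inl (h Y hYl hYi (by rw [show s l = t from hl]; exact hpl)).symm
        · rw [← h Y hYl hYi (by rw [show s l = t from hl]; exact hpl)]
          exact Or.inr ((hAt l).red.lt Y hYl hYi)
      have e2 := hFle (m+1) l hml Y (hYl.trans (hAt l).red.sub) hYi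
      rw [Fin m Y hYm] at e2
      have e3 := (hAt m).red.lt Y hYm hYi
      have e4 := hFle (n+1) m hnm Y (hYm.trans (hAt m).red.sub) hYi
      rw [Fin n Y hYn] at e4
      have e5 : F' n Y = v n ∨ lt (F' n Y) (v n) := by
        rcases hv n with h | h
        · rw [← h Y hYn hYi (by rw [show s n = t from hn]; exact hpn)]
          exact Or.inr ((hAt n).red.lt Y hYn hYi)
        · exact Or.inl (h Y hYn hYi (by rw [show s n = t from hn]; exact hpn))
      have c1 : lt (F l Y) (F m Y) := by
        rcases e2 with e | e
        · rwa [e]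
        · exact hltr _ _ _ e e3
      have c2 : lt (v l) (F m Y) := by
        rcases e1 with e | e
        · rwa [e]
        · exact hltr _ _ _ e c1
      have c3 : lt (v l) (F' n Y) := by
        rcases e4 with e | e
        · rwa [← e]
        · exact hltr _ _ _ c2 e
      rcases e5 with e | e
      · rwa [← e]
      · exact hltr _ _ _ c3 e
    obtain ⟨_, ⟨n, hn, rfl⟩, hminv⟩ := wf.has_min (v '' I) (hIinf.nonempty.image v)
    obtain ⟨m, hm, hnm⟩ := hIinf.exists_gt n
    obtain ⟨l, hl, hml⟩ := hIinf.exists_gt m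
    exact hminv _ ⟨l, hl, rfl⟩ (hdesc n hn m hm l hl hnm hml)
  -- the limit
  set Aω : Set ℕ := ⋂ n, A n with hAω
  have hωsub : ∀ n, Aω ⊆ A n := fun n => Set.iInter_subset _ n
  have hkω : ∀ n, k n ∈ Aω := by
    intro n
    have h1 : k n ∈ A n := (hAt n).red.sub ((hAt n).ss (hAt n).ks)
    refine Set.mem_iInter.2 fun m => ?_
    rcases le_total m n with h | h
    · exact hanti m n h h1
    · induction m, h using Nat.le_induction with
      | base => exact h1
      | succ m h ih => exact (mem_succ m _).2 (Or.inl ⟨ih, hkm h⟩)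
  have hωinf : Aω.Infinite := by
    apply Set.infinite_of_not_bddAbove
    rintro ⟨M, hM⟩
    obtain ⟨n, hn⟩ := hkub M
    exact absurd (hM (hkω n)) (not_le.2 hn)
  have hst : ∀ X : Set ℕ, ∃ v, X ⊆ Aω → X.Infinite → ∃ N, ∀ n ≥ N, F n X = v := by
    intro X
    obtain ⟨_, ⟨N, rfl⟩, hN⟩ := wf.has_min (Set.range fun n => F n X) ⟨_, ⟨0, rfl⟩⟩
    refine ⟨F N X, fun hX hi => ⟨N, fun n hn => ?_⟩⟩
    exact (hFle N n hn X (hX.trans (hωsub n)) hi).resolve_right (hN _ ⟨n, rfl⟩)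
  choose Fω hFω using hst
  have hωarr : Arr le Aω Fω := by
    refine ⟨hωinf, ?_, ?_⟩
    · intro X hX hi
      obtain ⟨N, hN⟩ := hFω X hX hi
      obtain ⟨j, hj⟩ := (hA N).loc X (hX.trans (hωsub N)) hi
      obtain ⟨M, hMX, hjM⟩ := inf_ex hi j
      have hnot : ∀ n ≥ N, ¬ X ⊆ A' n := by
        intro n hn hh
        have h1 := (hAt n).red.lt X hh hi
        rw [← Fin n X hh, hN n hn, hN (n+1) (by omega)] at h1
        exact irr _ h1
      have hexn : ∃ n, N ≤ n ∧ M < k n := by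
        obtain ⟨n, hn⟩ := hkub M
        exact ⟨max n N, le_max_right _ _, hn.trans_le (hkm (le_max_left _ _))⟩
      classical
      obtain ⟨hNn0, hMn0⟩ := Nat.find_spec hexn
      have hn0m : ∀ n, N ≤ n → n < Nat.find hexn → k n ≤ M := by
        intro n h1 h2
        have := Nat.find_min hexn h2
        by_contra h3
        exact this ⟨h1, not_le.1 h3⟩
      generalize Nat.find hexn = n0 at hNn0 hMn0 hn0m
      have hunm : ∀ Z ⊆ A n0, Z.Infinite → (∀ i ≤ M, i ∈ Z ↔ i ∈ X) →
          ∀ n, N ≤ n → n ≤ n0 → F n Z = F N X := by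
        intro Z hZ hZi hp n hn
        induction n, hn using Nat.le_induction with
        | base =>
          intro _
          exact hj Z (hZ.trans (hanti N n0 hNn0)) hZi fun i hi => hp i (hi.trans hjM)
        | succ n hn ih =>
          intro hnn
          rw [Fout, ih (by omega)]
          obtain ⟨x, hx, hxA⟩ := Set.not_subset.1 (hnot n hn)
          intro hh
          rcases (mem_succ n x).1 (hωsub _ (hX hx)) with h3 | h3
          · exact hxA (hh ((hp x (h3.2.trans (hn0m n hn (by omega)))).2 hx))
          · exact hxA h3.1
      have hns : ∀ n ≥ n0, ¬ {i | i ∈ X ∧ i ≤ M} ⊆ A' n := by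
        intro n hn hh
        have := hmin n0 (A' n) (F' n) M {i | i ∈ X ∧ i ≤ M}
          ⟨hRed n0 n hn _ _ (hAt n).red, hh, ⟨hMX, le_rfl⟩, fun i hi => hi.2, F N X, Or.inl ?_⟩
        · omega
        · intro Y hY hYi hp
          refine hunm Y (hY.trans ((hAt n).red.sub.trans (hanti n0 n hn))) hYi ?_ n0 hNn0 le_rfl
          intro i hi
          rw [hp i hi]
          exact ⟨fun h => h.1, fun h => ⟨h, hi⟩⟩
      refine ⟨M, fun Y hY hYi hp => ?_⟩
      have hall : ∀ n ≥ n0, F n Y = F N X := by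
        intro n hn
        induction n, hn using Nat.le_induction with
        | base => exact hunm Y (hY.trans (hωsub n0)) hYi hp n0 hNn0 le_rfl
        | succ n hn ih =>
          rw [Fout, ih]
          intro hh
          exact hns n hn fun i hi => hh ((hp i hi.2).2 hi.1)
      obtain ⟨N', hN'⟩ := hFω Y hY hYi
      rw [← hN' (max N' n0) (le_max_left _ _), hall _ (le_max_right _ _), hN N le_rfl]
    · intro X hX hi
      obtain ⟨N, hN⟩ := hFω X hX hi
      obtain ⟨N', hN'⟩ := hFω (tl X) ((tl_sub X).trans hX) (tl_inf hi)
      rw [← hN (max N N') (le_max_left _ _), ← hN' (max N N') (le_max_right _ _)]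
      exact (hA _).bad X (hX.trans (hωsub _)) hi
  obtain ⟨C, G, hr⟩ := hred Aω Fω hωarr
  obtain ⟨j, hj⟩ := hr.arr.loc C subset_rfl hr.arr.inf
  obtain ⟨M, hM, hjM⟩ := inf_ex hr.arr.inf j
  obtain ⟨n, hn⟩ := hkub M
  have := hmin n C G M {i | i ∈ C ∧ i ≤ M} ⟨⟨hr.sub.trans (hωsub n), hr.arr, ?_⟩, fun i hi => hi.1,
    ⟨hM, le_rfl⟩, fun i hi => hi.2, G C, Or.inr fun Y hY hYi hp => hj Y hY hYi fun i hi => ?_⟩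
  · omega
  · intro X hX hi
    have h1 := hr.lt X hX hi
    obtain ⟨N, hN⟩ := hFω X (hX.trans hr.sub) hi
    have h2 := hFle n (max n N) (le_max_left _ _) X (hX.trans (hr.sub.trans (hωsub _))) hi
    rw [hN _ (le_max_right _ _)] at h2
    rcases h2 with h2 | h2
    · rwa [← h2]
    · exact hltr _ _ _ h1 h2
  · rw [hp i (hi.trans hjM)]
    exact ⟨fun h => h.1, fun h => ⟨h, hi.trans hjM⟩⟩

/-! Clopen Ramsey theorem -/

def Rm (A₀ : Set ℕ) (G : Set ℕ → Prop) (s : Set ℕ) (m : ℕ) : Prop :=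
  ∀ A ⊆ A₀, A.Infinite → ∃ C ⊆ A, C.Infinite ∧ ∃ b : Prop,
    ∀ Y ⊆ C, Y.Infinite → (∀ i ∈ Y, m ≤ i) → (G (s ∪ Y) ↔ b)

theorem insert_tl {Y : Set ℕ} (h : Y.Nonempty) : insert (sInf Y) (tl Y) = Y := by
  rw [tl, Set.insert_sdiff_singleton]
  exact Set.insert_eq_of_mem (Nat.sInf_mem h)

theorem lt_of_mem_tl {Y : Set ℕ} {i : ℕ} (h : i ∈ tl Y) : sInf Y < i :=
  lt_of_le_of_ne (Nat.sInf_le h.1) (fun e => h.2 e.symm)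

theorem Rm_step (A₀ : Set ℕ) (G : Set ℕ → Prop) (s : Set ℕ) (m : ℕ)
    (h : ∀ n ∈ A₀, m ≤ n → Rm A₀ G (insert n s) (n+1)) : Rm A₀ G s m := by
  intro A hA hAi
  let St := {C : Set ℕ // C ⊆ A ∧ (∀ i ∈ C, m ≤ i) ∧ C.Infinite}
  have step : ∀ C : St, ∃ (n : ℕ) (D : St) (b : Prop), n ∈ C.1 ∧ D.1 ⊆ C.1 ∧ (∀ i ∈ D.1, n < i) ∧
      ∀ Y ⊆ D.1, Y.Infinite → (G (insert n s ∪ Y) ↔ b) := by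
    rintro ⟨C, hCA, hCm, hCi⟩
    obtain ⟨n, hn⟩ := hCi.nonempty
    obtain ⟨D, hD, hDi, b, hb⟩ := h n (hA (hCA hn)) (hCm n hn) {i | i ∈ C ∧ n < i}
      (fun i hi => hA (hCA hi.1)) (inf_gt hCi n)
    refine ⟨n, ⟨D, fun i hi => hCA (hD hi).1, fun i hi => hCm i (hD hi).1, hDi⟩, b, hn,
      fun i hi => (hD hi).1, fun i hi => (hD hi).2, fun Y hY hYi => hb Y hY hYi fun i hi => ?_⟩
    exact (hD (hY hi)).2
  choose cn cD cb h1 h2 h3 h4 using step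
  have hC0 : {i | i ∈ A ∧ m < i}.Infinite := inf_gt hAi m
  let sq : ℕ → St := fun n => cD^[n] ⟨{i | i ∈ A ∧ m < i}, fun i hi => hi.1,
    fun i hi => le_of_lt hi.2, hC0⟩
  have hsq : ∀ n, sq (n+1) = cD (sq n) := fun n => Function.iterate_succ_apply' _ _ _
  have hsub : ∀ i j, i ≤ j → (sq j).1 ⊆ (sq i).1 := by
    intro i j hij
    induction j, hij using Nat.le_induction with
    | base => exact subset_rfl
    | succ j _ ih => rw [hsq]; exact (h2 _).trans ih
  let nn : ℕ → ℕ := fun i => cn (sq i)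
  have hnn : StrictMono nn := by
    apply strictMono_nat_of_lt_succ
    intro i
    apply h3 (sq i)
    rw [← hsq]
    exact h1 _
  have hJ : ∃ (J : Set ℕ) (b : Prop), J.Infinite ∧ ∀ i ∈ J, (cb (sq i) ↔ b) := by
    by_cases hinf : {i | cb (sq i)}.Infinite
    · exact ⟨_, True, hinf, fun i hi => iff_true_intro hi⟩
    · refine ⟨{i | cb (sq i)}ᶜ, False, ?_, fun i hi => iff_false_intro hi⟩
      exact (Set.not_infinite.1 hinf).infinite_compl
  obtain ⟨J, b, hJi, hJb⟩ := hJ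
  refine ⟨nn '' J, ?_, hJi.image hnn.injective.injOn, b, ?_⟩
  · rintro _ ⟨i, _, rfl⟩
    exact (sq i).2.1 (h1 _)
  · intro Y hY hYi _
    obtain ⟨i, hi, hiY⟩ := hY (Nat.sInf_mem hYi.nonempty)
    have e : s ∪ Y = insert (nn i) s ∪ tl Y := by
      conv_lhs => rw [← insert_tl hYi.nonempty]
      rw [hiY, Set.union_insert, Set.insert_union]
    rw [e, ← hJb i hi]
    apply h4 _ _ _ (tl_inf hYi)
    intro x hx
    obtain ⟨j, _, rfl⟩ := hY hx.1
    have hij : i < j := hnn.lt_iff_lt.1 (by rw [hiY]; exact lt_of_mem_tl hx)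
    have := hsub (i+1) j hij (h1 (sq j))
    rwa [hsq] at this

theorem ramsey (A₀ : Set ℕ) (hA₀ : A₀.Infinite) (G : Set ℕ → Prop) (hG : Loc A₀ G) :
    ∃ C ⊆ A₀, C.Infinite ∧ ((∀ X ⊆ C, X.Infinite → G X) ∨ (∀ X ⊆ C, X.Infinite → ¬ G X)) := by
  have main : Rm A₀ G ∅ 0 := by
    by_contra hcon
    let St := {p : Set ℕ × ℕ // ¬ Rm A₀ G p.1 p.2}
    have step : ∀ p : St, ∃ n ∈ A₀, p.1.2 ≤ n ∧ ¬ Rm A₀ G (insert n p.1.1) (n+1) := by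
      intro p
      by_contra hc
      push Not at hc
      exact p.2 (Rm_step _ _ _ _ hc)
    choose cn h1 h2 h3 using step
    let nxt : St → St := fun p => ⟨(insert (cn p) p.1.1, cn p + 1), h3 p⟩
    let sq : ℕ → St := fun n => nxt^[n] ⟨(∅, 0), hcon⟩
    have hsq : ∀ n, sq (n+1) = nxt (sq n) := fun n => Function.iterate_succ_apply' _ _ _
    let nn : ℕ → ℕ := fun i => cn (sq i)
    have hm : ∀ i, (sq (i+1)).1.2 = nn i + 1 := by intro i; rw [hsq]
    have hs : ∀ i, (sq (i+1)).1.1 = insert (nn i) (sq i).1.1 := by intro i; rw [hsq]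
    have hnn : StrictMono nn := by
      apply strictMono_nat_of_lt_succ
      intro i
      have := h2 (sq (i+1))
      rw [hm] at this
      exact this
    have hS : ∀ i, (sq i).1.1 = {x | ∃ j < i, nn j = x} := by
      intro i
      induction i with
      | zero => ext x; simp [sq]
      | succ i ih =>
        rw [hs, ih]
        ext x
        simp only [Set.mem_insert_iff, Set.mem_ofPred_eq, Nat.lt_succ_iff_lt_or_eq]
        constructor
        · rintro (rfl | ⟨j, hj, rfl⟩)
          · exact ⟨i, Or.inr rfl, rfl⟩
          · exact ⟨j, Or.inl hj, rfl⟩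
        · rintro ⟨j, hj | rfl, rfl⟩
          · exact Or.inr ⟨j, hj, rfl⟩
          · exact Or.inl rfl
    have hXA : Set.range nn ⊆ A₀ := by rintro _ ⟨i, rfl⟩; exact h1 _
    have hXi : (Set.range nn).Infinite := Set.infinite_range_of_injective hnn.injective
    obtain ⟨k, hk⟩ := hG _ hXA hXi
    apply (sq (k+1)).2
    intro A hA hAi
    refine ⟨A, subset_rfl, hAi, G (Set.range nn), fun Y hY hYi hYm => ?_⟩
    rw [hm] at hYm
    rw [hS]
    have hkn : k ≤ nn k := hnn.le_apply
    refine iff_of_eq (hk _ ?_ ?_ ?_)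
    · rintro x (⟨j, _, rfl⟩ | hx)
      · exact h1 _
      · exact hA (hY hx)
    · exact hYi.mono Set.subset_union_right
    · intro i hi
      constructor
      · rintro (⟨j, _, rfl⟩ | hx)
        · exact ⟨j, rfl⟩
        · have := hYm i hx; omega
      · rintro ⟨j, rfl⟩
        refine Or.inl ⟨j, ?_, rfl⟩
        have := hnn.le_iff_le.1 (hi.trans hkn)
        omega
  obtain ⟨C, hC, hCi, b, hb⟩ := main A₀ subset_rfl hA₀
  refine ⟨C, hC, hCi, ?_⟩
  simp only [Set.empty_union, zero_le, implies_true, true_imp_iff] at hb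
  by_cases h : b
  · exact Or.inl fun X hX hi => (hb X hX hi).2 h
  · exact Or.inr fun X hX hi hG => h ((hb X hX hi).1 hG)

theorem Loc.pair {S T : Type*} {A : Set ℕ} {F : Set ℕ → S} (h : Loc A F) (c : S → S → T) :
    Loc A (fun X => c (F X) (F (tl X))) := by
  intro X hX hi
  obtain ⟨k, hk⟩ := h X hX hi
  obtain ⟨l, hl⟩ := h (tl X) ((tl_sub X).trans hX) (tl_inf hi)
  refine ⟨max (max k l) (sInf X), fun Y hY hYi hp => ?_⟩
  have hs : sInf Y = sInf X := by
    have h1 : sInf X ∈ Y := (hp _ (le_max_right _ _)).2 (Nat.sInf_mem hi.nonempty)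
    have h2 : sInf Y ≤ sInf X := Nat.sInf_le h1
    have h3 : sInf Y ∈ X := (hp _ (h2.trans (le_max_right _ _))).1 (Nat.sInf_mem hYi.nonempty)
    exact le_antisymm h2 (Nat.sInf_le h3)
  have e1 := hk Y hY hYi fun i hi => hp i (by omega)
  have e2 := hl (tl Y) ((tl_sub Y).trans hY) (tl_inf hYi) (fun i hi => by
    simp only [tl, hs, Set.mem_sdiff]
    rw [hp i (by omega)])
  simp only [e1, e2]

theorem Loc.comp {S T : Type*} {A : Set ℕ} {F : Set ℕ → S} (h : Loc A F) (c : S → T) :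
    Loc A (fun X => c (F X)) := h.pair (fun a _ => c a)

/-! Transfinite sequences -/

theorem emb_trans {Q : Type} [Preorder Q] (a b c : TSeq Q) (h : a.Emb b) (h' : b.Emb c) :
    a.Emb c := by
  obtain ⟨g, g1, g2, g3⟩ := h
  obtain ⟨k, k1, k2, k3⟩ := h'
  exact ⟨fun x => k (g x), fun β hβ => k1 _ (g1 _ hβ),
    fun β γ hβ hγ => k2 _ _ (g2 _ _ hβ hγ) (g1 _ hγ),
    fun β hβ => (g3 β hβ).trans (k3 _ (g1 _ hβ))⟩

def slt {Q : Type} (σ τ : TSeq Q) : Prop := σ.len < τ.len ∧ ∀ β < σ.len, σ.f β = τ.f β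

theorem slt_emb {Q : Type} [Preorder Q] (a b : TSeq Q) (h : slt a b) : a.Emb b :=
  ⟨fun x => x, fun _ hβ => hβ.trans h.1, fun _ _ h _ => h, fun β hβ => (h.2 β hβ).le⟩

theorem slt_trans {Q : Type} (a b c : TSeq Q) (h : slt a b) (h' : slt b c) : slt a c :=
  ⟨h.1.trans h'.1, fun β hβ => (h.2 β hβ).trans (h'.2 β (hβ.trans h.1))⟩

theorem slt_wf {Q : Type} : WellFounded (slt (Q := Q)) :=
  Subrelation.wf (fun h => h.1) (InvImage.wf TSeq.len Ordinal.lt_wf)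

theorem lim_emb {Q : Type} [Preorder Q] (σ τ : TSeq Q) (hl : ∀ γ < σ.len, γ + 1 < σ.len)
    (h : ∀ γ < σ.len, TSeq.Emb ⟨γ, σ.f⟩ τ) : σ.Emb τ := by
  let g : Ordinal → Ordinal := Ordinal.lt_wf.fix fun β ih =>
    sInf {δ | (∀ β' (hb : β' < β), ih β' hb < δ) ∧ σ.f β ≤ τ.f δ}
  have hg : ∀ β, g β = sInf {δ | (∀ β' < β, g β' < δ) ∧ σ.f β ≤ τ.f δ} := fun β =>
    Ordinal.lt_wf.fix_eq _ β
  have key : ∀ β < σ.len, g β ∈ {δ | (∀ β' < β, g β' < δ) ∧ σ.f β ≤ τ.f δ} ∧ g β < τ.len := by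
    intro β hβ
    obtain ⟨k, k1, k2, k3⟩ := h (β + 1) (hl β hβ)
    simp only at k1 k2 k3
    have hle : ∀ α, α < β + 1 → k α ∈ {δ | (∀ β' < α, g β' < δ) ∧ σ.f α ≤ τ.f δ} ∧ g α ≤ k α := by
      intro α
      induction α using Ordinal.lt_wf.induction with
      | _ α ih =>
        intro hα
        have hm : k α ∈ {δ | (∀ β' < α, g β' < δ) ∧ σ.f α ≤ τ.f δ} :=
          ⟨fun β' hb => (ih β' hb (hb.trans hα)).2.trans_lt (k2 _ _ hb hα), k3 _ hα⟩
        refine ⟨hm, ?_⟩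
        rw [hg α]
        exact csInf_le' hm
    have hb : β < β + 1 := lt_add_one β
    refine ⟨?_, (hle β hb).2.trans_lt (k1 _ hb)⟩
    have := csInf_mem (s := {δ | (∀ β' < β, g β' < δ) ∧ σ.f β ≤ τ.f δ}) ⟨_, (hle β hb).1⟩
    rwa [← hg β] at this
  exact ⟨g, fun β hβ => (key β hβ).2, fun β γ hb hγ => (key γ hγ).1.1 β hb,
    fun β hβ => (key β hβ).1.2⟩

theorem succ_emb {Q : Type} [Preorder Q] (σ τ : TSeq Q) (a b : Ordinal) (ha : σ.len = a + 1)
    (hb : τ.len = b + 1) (h : TSeq.Emb ⟨a, σ.f⟩ ⟨b, τ.f⟩) (hq : σ.f a ≤ τ.f b) : σ.Emb τ := by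
  classical
  obtain ⟨k, k1, k2, k3⟩ := h
  simp only at k1 k2 k3
  refine ⟨fun x => if x < a then k x else b, ?_, ?_, ?_⟩
  · intro β hβ
    rw [hb]
    by_cases h1 : β < a
    · simp only [h1, if_true]; exact (k1 β h1).trans (lt_add_one b)
    · simp only [h1, if_false]; exact lt_add_one b
  · intro β γ hβ hγ
    rw [ha] at hγ
    have h1 : β < a := hβ.trans_le (Order.lt_add_one_iff.1 hγ)
    by_cases h2 : γ < a
    · simp only [h1, h2, if_true]; exact k2 _ _ hβ h2
    · simp only [h1, h2, if_true, if_false]; exact k1 β h1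
  · intro β hβ
    rw [ha] at hβ
    by_cases h1 : β < a
    · simp only [h1, if_true]; exact k3 β h1
    · have : β = a := le_antisymm (Order.lt_add_one_iff.1 hβ) (not_lt.1 h1)
      simp only [h1, if_false]; rw [this]; exact hq

theorem reduce {Q : Type} [Preorder Q]
    (hQ : ∀ A (q : Set ℕ → Q), ¬ Arr (· ≤ ·) A q)
    (A : Set ℕ) (F : Set ℕ → TSeq Q) (h : Arr TSeq.Emb A F) :
    ∃ A' F', Redn TSeq.Emb slt A F A' F' := by
  obtain ⟨C, hC, hCi, hs | hs⟩ := ramsey A h.inf (fun X => ∃ γ, (F X).len = γ + 1)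
    (h.loc.comp fun σ => ∃ γ, σ.len = γ + 1)
  · have hp : ∀ σ : TSeq Q, ∃ γ, (∃ γ, σ.len = γ + 1) → σ.len = γ + 1 := by
      intro σ
      by_cases hh : ∃ γ, σ.len = γ + 1
      · obtain ⟨γ, hγ⟩ := hh; exact ⟨γ, fun _ => hγ⟩
      · exact ⟨0, fun h => absurd h hh⟩
    choose p hp using hp
    have hC' := h.loc.mono hC
    obtain ⟨D, hD, hDi, hd | hd⟩ := ramsey C hCi
      (fun X => TSeq.Emb ⟨p (F X), (F X).f⟩ ⟨p (F (tl X)), (F (tl X)).f⟩)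
      (hC'.pair fun σ τ => TSeq.Emb ⟨p σ, σ.f⟩ ⟨p τ, τ.f⟩)
    · exfalso
      refine hQ D (fun X => (F X).f (p (F X))) ⟨hDi, (hC'.mono hD).comp fun σ => σ.f (p σ), ?_⟩
      intro X hX hi hle
      refine h.bad X (hX.trans (hD.trans hC)) hi (succ_emb _ _ _ _ (hp _ (hs X (hX.trans hD) hi))
        (hp _ (hs _ ((tl_sub X).trans (hX.trans hD)) (tl_inf hi))) (hd X hX hi) hle)
    · refine ⟨D, fun X => ⟨p (F X), (F X).f⟩, hD.trans hC,
        ⟨hDi, (hC'.mono hD).comp fun σ => (⟨p σ, σ.f⟩ : TSeq Q), hd⟩, ?_⟩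
      intro X hX hi
      refine ⟨?_, fun _ _ => rfl⟩
      conv_rhs => rw [hp _ (hs X (hX.trans hD) hi)]
      exact lt_add_one _
  · have hc : ∀ σ τ : TSeq Q, ∃ γ, (¬ ∃ γ, σ.len = γ + 1) → ¬ σ.Emb τ →
        γ < σ.len ∧ ¬ TSeq.Emb ⟨γ, σ.f⟩ τ := by
      intro σ τ
      by_cases h1 : ∃ γ, σ.len = γ + 1
      · exact ⟨0, fun h => absurd h1 h⟩
      by_cases h2 : σ.Emb τ
      · exact ⟨0, fun _ h => absurd h2 h⟩
      by_contra hcon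
      push Not at hcon
      apply h2
      apply lim_emb
      · intro γ hγ
        refine lt_of_le_of_ne (Order.add_one_le_of_lt hγ) fun e => h1 ⟨γ, e.symm⟩
      · intro γ hγ
        exact (hcon γ).2.2 hγ
    choose c hc using hc
    refine ⟨C, fun X => ⟨c (F X) (F (tl X)), (F X).f⟩, hC, ⟨hCi,
      (h.loc.mono hC).pair fun σ τ => (⟨c σ τ, σ.f⟩ : TSeq Q), ?_⟩, ?_⟩
    · intro X hX hi hh
      have h1 := hc _ _ (hs X hX hi) (h.bad X (hX.trans hC) hi)
      have hX' := (tl_sub X).trans hX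
      have h2 := hc _ _ (hs _ hX' (tl_inf hi)) (h.bad _ (hX'.trans hC) (tl_inf hi))
      exact h1.2 (emb_trans _ _ _ hh (slt_emb _ _ ⟨h2.1, fun _ _ => rfl⟩))
    · intro X hX hi
      exact ⟨(hc _ _ (hs X hX hi) (h.bad X (hX.trans hC) hi)).1, fun _ _ => rfl⟩

/-! From continuous arrays to barriers and back -/

def IS (s : Finset ℕ) (X : Set ℕ) : Prop := (∀ x ∈ s, x ∈ X) ∧ ∀ x ∈ X, x ∉ s → ∀ y ∈ s, y < x

theorem IS.comp {s t : Finset ℕ} {X : Set ℕ} (hs : IS s X) (ht : IS t X) : s ⊆ t ∨ t ⊆ s := by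
  by_contra h
  push Not at h
  obtain ⟨⟨x, hx, hxt⟩, ⟨y, hy, hys⟩⟩ := And.imp Finset.not_subset.1 Finset.not_subset.1 h
  have h1 := hs.2 y (ht.1 y hy) hys x hx
  have h2 := ht.2 x (hs.1 x hx) hxt y hy
  omega

def ext' (A : Set ℕ) (s : Finset ℕ) : Set ℕ := {i | i ∈ s ∨ (i ∈ A ∧ ∀ y ∈ s, y < i)}

theorem ext_inf {A : Set ℕ} (hA : A.Infinite) (s : Finset ℕ) : (ext' A s).Infinite := by
  refine (inf_gt hA (s.sup id)).mono fun i hi => Or.inr ⟨hi.1, fun y hy => ?_⟩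
  exact (Finset.le_sup (f := id) hy).trans_lt hi.2

theorem ext_sub {A : Set ℕ} {s : Finset ℕ} (hs : ∀ x ∈ s, x ∈ A) : ext' A s ⊆ A := by
  rintro i (h | h)
  · exact hs i h
  · exact h.1

theorem ext_IS {A : Set ℕ} {s : Finset ℕ} : IS s (ext' A s) :=
  ⟨fun _ hx => Or.inl hx, fun _ hx hn => (hx.resolve_left hn).2⟩

theorem no_bad_Q {Q : Type} [Preorder Q]
    (hQ : ∀ B : Set (List ℕ), IsBarrier B → ∀ f : List ℕ → Q,
      ∃ s ∈ B, ∃ t ∈ B, Tri s t ∧ f s ≤ f t)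
    (A : Set ℕ) (q : Set ℕ → Q) (h : Arr (· ≤ ·) A q) : False := by
  classical
  let D : Finset ℕ → Prop := fun s => (∀ x ∈ s, x ∈ A) ∧ 2 ≤ s.card ∧
    ∀ X ⊆ A, X.Infinite → ∀ Y ⊆ A, Y.Infinite → IS s X → IS s Y → q X = q Y
  have fa : ∀ X ⊆ A, X.Infinite → ∃ s, D s ∧ IS s X := by
    intro X hX hi
    obtain ⟨k, hk⟩ := h.loc X hX hi
    obtain ⟨a, ha⟩ := hi.nonempty
    obtain ⟨b, hb, hab⟩ := hi.exists_gt (max a k)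
    set s : Finset ℕ := (Finset.range (b+1)).filter (· ∈ X) with hs
    have ms : ∀ x, x ∈ s ↔ x ≤ b ∧ x ∈ X := by
      intro x; rw [hs, Finset.mem_filter, Finset.mem_range, Nat.lt_succ_iff]
    have hc : ∀ Y ⊆ A, Y.Infinite → IS s Y → q Y = q X := by
      intro Y hY hYi hIS
      refine hk Y hY hYi fun i hik => ?_
      constructor
      · intro hiY
        by_contra hn
        have : i ∉ s := fun hh => hn ((ms i).1 hh).2
        have := hIS.2 i hiY this b ((ms b).2 ⟨le_rfl, hb⟩)
        omega
      · intro hiX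
        exact hIS.1 i ((ms i).2 ⟨by omega, hiX⟩)
    refine ⟨s, ⟨fun x hx => hX ((ms x).1 hx).2, ?_, ?_⟩, fun x hx => ((ms x).1 hx).2, ?_⟩
    · have : ({a, b} : Finset ℕ) ⊆ s := by
        intro x hx
        rw [Finset.mem_insert, Finset.mem_singleton] at hx
        rcases hx with rfl | rfl
        · exact (ms _).2 ⟨by omega, ha⟩
        · exact (ms _).2 ⟨le_rfl, hb⟩
      have h2 := Finset.card_le_card this
      rwa [Finset.card_pair (by omega)] at h2
    · intro Y hY hYi Z hZ hZi h1 h2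
      rw [hc Y hY hYi h1, hc Z hZ hZi h2]
    · intro x hx hxs y hy
      have h1 := ((ms y).1 hy).1
      by_contra h2
      exact hxs ((ms x).2 ⟨by omega, hx⟩)
  let M : Finset ℕ → Prop := fun s => D s ∧ ∀ t ⊂ s, ¬ D t
  let G : Set ℕ → Prop := fun X => ∃ s, M s ∧ IS s X
  have trans : ∀ s X Y, D s → IS s X → IS s Y → G Y → G X := by
    rintro s X Y hD hX hY ⟨t, ht, htY⟩
    have hts : t ⊆ s := by
      rcases htY.comp hY with h1 | h1
      · exact h1
      · by_contra h2
        exact ht.2 s ⟨h1, h2⟩ hD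
    refine ⟨t, ht, fun x hx => hX.1 x (hts hx), fun x hx hxt y hy => ?_⟩
    by_cases hxs : x ∈ s
    · exact htY.2 x (hY.1 x hxs) hxt y hy
    · exact hX.2 x hx hxs y (hts hy)
  have hGloc : Loc A G := by
    intro X hX hi
    obtain ⟨s, hs, hIS⟩ := fa X hX hi
    refine ⟨s.sup id, fun Y hY hYi hp => ?_⟩
    have hle : ∀ y ∈ s, y ≤ s.sup id := fun y hy => Finset.le_sup (f := id) hy
    have hYS : IS s Y := by
      refine ⟨fun x hx => (hp x (hle x hx)).2 (hIS.1 x hx), fun x hx hxs y hy => ?_⟩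
      by_cases hxk : x ≤ s.sup id
      · exact hIS.2 x ((hp x hxk).1 hx) hxs y hy
      · have := hle y hy; omega
    exact propext ⟨trans s X Y hs hIS hYS, trans s Y X hs hYS hIS⟩
  obtain ⟨C, hC, hCi, hG | hG⟩ := ramsey A h.inf G hGloc
  swap
  · -- impossible
    have hex : ∃ n, ∃ s : Finset ℕ, s.card = n ∧ D s ∧ ∀ x ∈ s, x ∈ C := by
      obtain ⟨s, hs, hIS⟩ := fa C hC hCi
      exact ⟨_, s, rfl, hs, hIS.1⟩
    obtain ⟨s, hsc, hsD, hsC⟩ := Nat.find_spec hex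
    refine hG (ext' C s) (ext_sub hsC) (ext_inf hCi s) ⟨s, ⟨hsD, fun t ht htD => ?_⟩, ext_IS⟩
    have := Finset.card_lt_card ht
    rw [hsc] at this
    exact Nat.find_min hex this ⟨t, rfl, htD, fun x hx => hsC x (ht.1 hx)⟩
  let B : Set (List ℕ) := {l | l.Pairwise (· < ·) ∧ (∀ x ∈ l, x ∈ C) ∧ M l.toFinset}
  have hbase : ∀ n ∈ base B, n ∈ C := by
    rintro n ⟨l, hl, hn⟩
    exact hl.2.1 n hn
  have hseg : ∀ f : ℕ → ℕ, StrictMono f → (∀ n, f n ∈ C) → ∃ k, (List.range k).map f ∈ B := by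
    intro f hf hfC
    have hfi : (Set.range f).Infinite := Set.infinite_range_of_injective hf.injective
    obtain ⟨s, hs, hIS⟩ := hG (Set.range f) (by rintro _ ⟨i, rfl⟩; exact hfC i) hfi
    have hex : ∃ j, f j ∉ s := by
      by_contra hc
      push Not at hc
      exact hfi (s.finite_toSet.subset (by rintro _ ⟨i, rfl⟩; exact hc i))
    have hj := Nat.find_spec hex
    refine ⟨Nat.find hex, ?_, ?_, ?_⟩
    · rw [List.pairwise_map]
      exact List.pairwise_lt_range.imp fun h => hf h
    · intro x hx
      obtain ⟨i, _, rfl⟩ := List.mem_map.1 hx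
      exact hfC i
    · convert hs
      ext x
      simp only [List.mem_toFinset, List.mem_map, List.mem_range]
      constructor
      · rintro ⟨i, hi, rfl⟩
        by_contra hn
        exact Nat.find_min hex hi hn
      · intro hx
        obtain ⟨i, rfl⟩ := hIS.1 x hx
        exact ⟨i, hf.lt_iff_lt.1 (hIS.2 _ ⟨_, rfl⟩ hj _ hx), rfl⟩
  have hB : IsBarrier B := by
    refine ⟨fun s hs => List.Pairwise.isChain hs.1, ?_, fun f hf hfB => hseg f hf fun n => hbase _ (hfB n), ?_⟩
    · apply Set.infinite_of_not_bddAbove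
      rintro ⟨N, hN⟩
      have hi := inf_gt hCi N
      obtain ⟨k, hk⟩ := hseg (Nat.nth (· ∈ {i | i ∈ C ∧ N < i})) (Nat.nth_strictMono hi)
        (fun n => (Nat.nth_mem_of_infinite hi n).1)
      have hc : 2 ≤ _ := hk.2.2.1.2.1
      obtain ⟨x, hx⟩ := Finset.card_pos.1 (lt_of_lt_of_le Nat.zero_lt_two hc)
      rw [List.mem_toFinset] at hx
      have h1 := hN ⟨_, hk, hx⟩
      obtain ⟨i, _, rfl⟩ := List.mem_map.1 hx
      have h3 := (Nat.nth_mem_of_infinite hi i).2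
      exact absurd h1 (not_le.2 h3)
    · intro s hs t ht hst n hn
      by_contra hns
      refine ht.2.2.2 s.toFinset ⟨?_, ?_⟩ hs.2.2.1
      · intro x hx
        rw [List.mem_toFinset] at hx ⊢
        exact hst x hx
      · intro hh
        exact hns (List.mem_toFinset.1 (hh (List.mem_toFinset.2 hn)))
  obtain ⟨s, hs, t, ht, ⟨u, hsu, htu⟩, hle⟩ := hQ B hB (fun l => q (ext' C l.toFinset))
  have hlen : 2 ≤ s.length := hs.2.2.1.2.1.trans (List.toFinset_card_le s)
  obtain ⟨a, w, hw, haw, hsw, htw⟩ : ∃ a w, (a :: w).Pairwise (· < ·) ∧ (∀ x ∈ a :: w, x ∈ C) ∧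
      s <+: a :: w ∧ t <+: w := by
    rcases s with _ | ⟨a, _ | ⟨b, s'⟩⟩
    · simp at hlen
    · simp at hlen
    · have h1 : (b :: s') <+: u.tail := by
        obtain ⟨r, rfl⟩ := hsu
        exact ⟨r, rfl⟩
      rcases List.prefix_or_prefix_of_prefix h1 htu with h2 | h2
      · refine ⟨a, t, ?_, ?_, ?_, List.prefix_rfl⟩
        · obtain ⟨r, rfl⟩ := h2
          have hab : a < b := (List.pairwise_cons.1 hs.1).1 b (by simp)
          refine List.pairwise_cons.2 ⟨fun x hx => ?_, ht.1⟩
          rw [List.cons_append, List.mem_cons] at hx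
          rcases hx with rfl | hx
          · exact hab
          · exact hab.trans ((List.pairwise_cons.1 ht.1).1 x hx)
        · intro x hx
          rcases List.mem_cons.1 hx with rfl | hx
          · exact hs.2.1 _ (by simp)
          · exact ht.2.1 x hx
        · obtain ⟨r, rfl⟩ := h2
          exact ⟨r, rfl⟩
      · exact ⟨a, b :: s', hs.1, hs.2.1, List.prefix_rfl, h2⟩
  have gen : ∀ l v : List ℕ, l <+: v → v.Pairwise (· < ·) → ∀ X : Set ℕ,
      (∀ x, x ∈ X ↔ x ∈ v ∨ (x ∈ C ∧ ∀ y ∈ a :: w, y < x)) → (∀ x ∈ v, x ∈ a :: w) →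
      IS l.toFinset X := by
    rintro l v ⟨r, rfl⟩ hv X hX hvw
    refine ⟨fun x hx => (hX x).2 (Or.inl ?_), fun x hx hxl y hy => ?_⟩
    · rw [List.mem_toFinset] at hx
      exact List.mem_append_left _ hx
    · rw [List.mem_toFinset] at hxl hy
      rcases (hX x).1 hx with h1 | h1
      · have h2 := (List.mem_append.1 h1).resolve_left hxl
        exact (List.pairwise_append.1 hv).2.2 y hy x h2
      · exact h1.2 y (hvw y (List.mem_append_left _ hy))
  let X : Set ℕ := ext' C (a :: w).toFinset
  have hXC : X ⊆ C := ext_sub fun x hx => haw x (List.mem_toFinset.1 hx)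
  have hXi : X.Infinite := ext_inf hCi _
  have mX : ∀ x, x ∈ X ↔ x ∈ a :: w ∨ (x ∈ C ∧ ∀ y ∈ a :: w, y < x) := by
    intro x
    simp only [X, ext', Set.mem_ofPred_eq, List.mem_toFinset]
  have haX : ∀ x ∈ X, x = a ∨ a < x := by
    intro x hx
    rcases (mX x).1 hx with h1 | h1
    · rcases List.mem_cons.1 h1 with h2 | h2
      · exact Or.inl h2
      · exact Or.inr ((List.pairwise_cons.1 hw).1 x h2)
    · exact Or.inr (h1.2 a (by simp))
  have hsI : sInf X = a := by
    apply le_antisymm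
    · exact Nat.sInf_le ((mX a).2 (Or.inl (by simp)))
    · rcases haX _ (Nat.sInf_mem hXi.nonempty) with h1 | h1 <;> omega
  have mtX : ∀ x, x ∈ tl X ↔ x ∈ w ∨ (x ∈ C ∧ ∀ y ∈ a :: w, y < x) := by
    intro x
    rw [tl, Set.mem_sdiff, hsI, mX, Set.mem_singleton_iff, List.mem_cons]
    constructor
    · rintro ⟨(h1 | h1) | h1, h2⟩
      · exact absurd h1 h2
      · exact Or.inl h1
      · exact Or.inr h1
    · rintro (h1 | h1)
      · have := (List.pairwise_cons.1 hw).1 x h1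
        exact ⟨Or.inl (Or.inr h1), by omega⟩
      · have := h1.2 a (by simp)
        exact ⟨Or.inr h1, by omega⟩
  have i1 : IS s.toFinset X := gen s (a :: w) hsw hw X mX fun x hx => hx
  have i2 : IS t.toFinset (tl X) := gen t w htw (List.pairwise_cons.1 hw).2 (tl X) mtX
    fun x hx => List.mem_cons_of_mem _ hx
  have hsub : ∀ l ∈ B, ext' C l.toFinset ⊆ A := fun l hl =>
    (ext_sub fun x hx => hl.2.1 x (List.mem_toFinset.1 hx)).trans hC
  have e1 := hs.2.2.1.2.2 _ (hsub s hs) (ext_inf hCi _) X (hXC.trans hC) hXi ext_IS i1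
  have e2 := ht.2.2.1.2.2 _ (hsub t ht) (ext_inf hCi _) (tl X) ((tl_sub X).trans (hXC.trans hC))
    (tl_inf hXi) ext_IS i2
  have hle' : q (ext' C s.toFinset) ≤ q (ext' C t.toFinset) := hle
  rw [e1, e2] at hle'
  exact h.bad X (hXC.trans hC) hXi hle'

theorem nth_tl {X : Set ℕ} (hX : X.Infinite) :
    Nat.nth (· ∈ tl X) = fun i => Nat.nth (· ∈ X) (i + 1) := by
  have hm := Nat.nth_strictMono (p := (· ∈ X)) hX
  have h1 : StrictMono fun i => Nat.nth (· ∈ X) (i + 1) := fun i j h => hm (by omega)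
  have h2 : StrictMono (Nat.nth (· ∈ tl X)) := Nat.nth_strictMono (p := (· ∈ tl X)) (tl_inf hX)
  refine (h2.range_inj h1).1 ?_
  rw [Nat.range_nth_of_infinite (p := (· ∈ tl X)) (tl_inf hX)]
  have h0 : Nat.nth (· ∈ X) 0 = sInf X := Nat.nth_zero
  have hr := Nat.range_nth_of_infinite (p := (· ∈ X)) hX
  ext x
  constructor
  · rintro ⟨hx, hn⟩
    have : x ∈ Set.range (Nat.nth (· ∈ X)) := by rw [hr]; exact hx
    obtain ⟨i, rfl⟩ := this
    cases i with
    | zero => exact absurd h0 hn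
    | succ i => exact ⟨i, rfl⟩
  · rintro ⟨i, rfl⟩
    refine ⟨Nat.nth_mem_of_infinite (p := (· ∈ X)) hX _, fun e => ?_⟩
    have e' : Nat.nth (· ∈ X) (i+1) = sInf X := e
    have : Nat.nth (· ∈ X) 0 < Nat.nth (· ∈ X) (i+1) := hm (Nat.succ_pos i)
    rw [h0] at this
    omega

theorem range_pre {a b : ℕ} (h : a ≤ b) : List.range a <+: List.range b := by
  obtain ⟨d, rfl⟩ := Nat.exists_eq_add_of_le h
  rw [List.range_add]
  exact List.prefix_append _ _

theorem to_arr {S : Type*} (le : S → S → Prop) (B : Set (List ℕ)) (hB : IsBarrier B)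
    (F : List ℕ → S) (hF : ∀ s ∈ B, ∀ t ∈ B, Tri s t → ¬ le (F s) (F t)) :
    ∃ A Φ, Arr le A Φ := by
  obtain ⟨hch, hinf, hseg, hanti⟩ := hB
  have hex : ∀ X : Set ℕ, ∃ k, X ⊆ base B → X.Infinite →
      (List.range k).map (Nat.nth (· ∈ X)) ∈ B := by
    intro X
    by_cases h : X ⊆ base B ∧ X.Infinite
    · obtain ⟨k, hk⟩ := hseg (Nat.nth (· ∈ X)) (Nat.nth_strictMono (p := (· ∈ X)) h.2)
        fun n => h.1 (Nat.nth_mem_of_infinite (p := (· ∈ X)) h.2 n)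
      exact ⟨k, fun _ _ => hk⟩
    · exact ⟨0, fun h1 h2 => absurd ⟨h1, h2⟩ h⟩
  choose K hK using hex
  let seg : Set ℕ → List ℕ := fun X => (List.range (K X)).map (Nat.nth (· ∈ X))
  have mseg : ∀ X x, x ∈ seg X ↔ ∃ i < K X, Nat.nth (· ∈ X) i = x := by
    intro X x; simp [seg]
  have hsIS : ∀ X ⊆ base B, ∀ _ : X.Infinite, ∀ Y : Set ℕ,
      (∀ i ≤ Nat.nth (· ∈ X) (K X), i ∈ Y ↔ i ∈ X) → IS (seg X).toFinset Y := by
    intro X hX hi Y hp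
    have hm := Nat.nth_strictMono (p := (· ∈ X)) hi
    refine ⟨fun x hx => ?_, fun x hx hxs y hy => ?_⟩
    · rw [List.mem_toFinset, mseg] at hx
      obtain ⟨i, hik, rfl⟩ := hx
      exact (hp _ (hm.monotone hik.le)).2 (Nat.nth_mem_of_infinite (p := (· ∈ X)) hi i)
    · rw [List.mem_toFinset, mseg] at hxs hy
      obtain ⟨i, hik, rfl⟩ := hy
      by_cases hxk : x ≤ Nat.nth (· ∈ X) (K X)
      · have hxX := (hp x hxk).1 hx
        have : x ∈ Set.range (Nat.nth (· ∈ X)) := by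
          rw [Nat.range_nth_of_infinite (p := (· ∈ X)) hi]; exact hxX
        obtain ⟨j, rfl⟩ := this
        apply hm
        by_contra hji
        exact hxs ⟨j, by omega, rfl⟩
      · exact (hm hik).trans (not_le.1 hxk)
  refine ⟨base B, fun X => F (seg X), hinf, ?_, ?_⟩
  · intro X hX hi
    refine ⟨Nat.nth (· ∈ X) (K X), fun Y hY hYi hp => ?_⟩
    have h1 := hsIS X hX hi Y hp
    have h2 := hsIS Y hY hYi Y fun _ _ => Iff.rfl
    have b1 : seg X ∈ B := hK X hX hi
    have b2 : seg Y ∈ B := hK Y hY hYi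
    have hset : ∀ x, x ∈ seg Y ↔ x ∈ seg X := by
      intro x
      rcases h1.comp h2 with h3 | h3
      · have h4 : ∀ n, n ∈ seg X → n ∈ seg Y := fun n hn =>
          List.mem_toFinset.1 (h3 (List.mem_toFinset.2 hn))
        exact ⟨hanti _ b1 _ b2 h4 x, h4 x⟩
      · have h4 : ∀ n, n ∈ seg Y → n ∈ seg X := fun n hn =>
          List.mem_toFinset.1 (h3 (List.mem_toFinset.2 hn))
        exact ⟨h4 x, hanti _ b2 _ b1 h4 x⟩
    have p1 : (seg X).Pairwise (· < ·) := List.isChain_iff_pairwise.1 (hch _ b1)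
    have p2 : (seg Y).Pairwise (· < ·) := List.isChain_iff_pairwise.1 (hch _ b2)
    have : seg Y = seg X := by
      have hperm : (seg Y).Perm (seg X) :=
        (List.perm_ext_iff_of_nodup (p2.imp fun h => h.ne) (p1.imp fun h => h.ne)).2 hset
      exact hperm.eq_of_pairwise (fun a b _ _ h h' => absurd h (lt_asymm h')) p2 p1
    simp only [this]
  · intro X hX hi
    refine hF _ (hK X hX hi) _ (hK _ ((tl_sub X).trans hX) (tl_inf hi)) ?_
    refine ⟨(List.range (max (K X) (K (tl X)) + 1)).map (Nat.nth (· ∈ X)), ?_, ?_⟩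
    · apply List.IsPrefix.map
      exact range_pre (by omega)
    · show (List.range (K (tl X))).map (Nat.nth (· ∈ tl X)) <+: _
      rw [nth_tl hi, List.range_succ_eq_map, List.map_cons, List.tail_cons, List.map_map]
      apply List.IsPrefix.map
      exact range_pre (by omega)

end NW

/-- Nash-Williams' theorem: if `Q` is bqo then `Q̃` (countable transfinite
sequences under embeddability) is bqo: every `Q̃`-array is good. -/
theorem stmt_13 {Q : Type} [Preorder Q]
    (hQ : ∀ B : Set (List ℕ), IsBarrier B → ∀ f : List ℕ → Q,
      ∃ s ∈ B, ∃ t ∈ B, Tri s t ∧ f s ≤ f t) :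
    ∀ B : Set (List ℕ), IsBarrier B → ∀ F : List ℕ → TSeq Q,
      (∀ s : List ℕ, (F s).len.card ≤ Cardinal.aleph0) →
      ∃ s ∈ B, ∃ t ∈ B, Tri s t ∧ TSeq.Emb (F s) (F t) := by
  intro B hB F _
  by_contra hcon
  push Not at hcon
  obtain ⟨A, Φ, h⟩ := NW.to_arr TSeq.Emb B hB F hcon
  exact NW.no_bad NW.emb_trans NW.slt_emb NW.slt_trans NW.slt_wf
    (NW.reduce fun A q hq => NW.no_bad_Q hQ A q hq) A Φ h
end
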